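/- arXiv:1901.01510 — 2 statements merged into one kernel-verified Lean document; each statement's English description precedes it below -/
import Mathlib

section
/- Let q⃗ = (q₁,q₂,q₃) with q_j ∈ [2,∞) for each j and 0 ≤ 1/q̄ − 1/2 ≤ 1, where 1/q̄ := 1/q₁+1/q₂+1/q₃. There exists a constant C, depending only on q⃗, such that for all 0 < ξ < η and every f ∈ C^∞(ℝ³): ‖f‖_{L^{q⃗}(B((ξ+3η)/4))} ≤ C · ‖∇f‖_{L²(B(η))}^{3/2 − 1/q̄} · ‖f‖_{L²(B(η))}^{1/q̄ − 1/2} + C · (η − ξ)^{−(3/2 − 1/q̄)} · ‖f‖_{L²(B(η))}. -/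
open MeasureTheory ENNReal Set Metric Filter

noncomputable section

/-- Euclidean 3-space. -/
abbrev E3 : Type := EuclideanSpace ℝ (Fin 3)

/-- The point (x₁,x₂,x₃) of ℝ³. -/
def pt3 (x1 x2 x3 : ℝ) : E3 := (WithLp.equiv 2 (Fin 3 → ℝ)).symm ![x1, x2, x3]

/-- Anisotropic Lebesgue (quasi-)norm `‖f‖_{L^{q⃗}(Ω)}` with finite exponents:
iterated L^{q₁}, L^{q₂}, L^{q₃} norms in x₁, x₂, x₃ of f extended by 0 outside Ω. -/
def anisoNorm (q1 q2 q3 : ℝ) (Ω : Set E3) (f : E3 → ℝ) : ℝ≥0∞ :=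
  (∫⁻ x3 : ℝ, (∫⁻ x2 : ℝ, (∫⁻ x1 : ℝ,
      (ENNReal.ofReal |Ω.indicator f (pt3 x1 x2 x3)|) ^ q1) ^ (q2 / q1)) ^ (q3 / q2)) ^ (1 / q3)

/-- Partial derivative in the i-th coordinate direction. -/
def pd (i : Fin 3) (f : E3 → ℝ) (x : E3) : ℝ := fderiv ℝ f x (EuclideanSpace.single i 1)

/-- Laplacian. -/
def lap (f : E3 → ℝ) (x : E3) : ℝ := ∑ i : Fin 3, pd i (fun y => pd i f y) x

/-- `L²` norm of a scalar function over a set. -/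
def l2On (s : Set E3) (g : E3 → ℝ) : ℝ≥0∞ :=
  (∫⁻ x in s, (ENNReal.ofReal |g x|) ^ 2) ^ ((1:ℝ)/2)


lemma as_mink {α β : Type*} [MeasurableSpace α] [MeasurableSpace β] (μ : Measure α) (ν : Measure β)
    [SFinite μ] [SFinite ν] (F : α → β → ℝ≥0∞) (hF : Measurable (Function.uncurry F)) :
    (∫⁻ x, (∫⁻ y, F x y ∂ν) ^ (2:ℝ) ∂μ) ^ ((1:ℝ)/2) ≤ ∫⁻ y, (∫⁻ x, F x y ^ (2:ℝ) ∂μ) ^ ((1:ℝ)/2) ∂ν := by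
  have hF1 : ∀ x, Measurable (F x) := fun x => hF.of_uncurry_left
  have hF2 : ∀ y, Measurable (fun x => F x y) := fun y => hF.of_uncurry_right
  set N : β → ℝ≥0∞ := fun y => (∫⁻ x, F x y ^ (2:ℝ) ∂μ) ^ ((1:ℝ)/2) with hN
  have hNm : Measurable N := by
    apply Measurable.pow_const
    apply Measurable.lintegral_prod_left' (f := fun p : α × β => F p.1 p.2 ^ (2:ℝ))
    exact Measurable.pow_const hF _
  have key : ∫⁻ x, (∫⁻ y, F x y ∂ν) ^ (2:ℝ) ∂μ ≤ (∫⁻ y, N y ∂ν) ^ (2:ℝ) := by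
    calc ∫⁻ x, (∫⁻ y, F x y ∂ν) ^ (2:ℝ) ∂μ 
        = ∫⁻ x, ∫⁻ p : β × β, F x p.1 * F x p.2 ∂(ν.prod ν) ∂μ := by
          congr 1; ext x
          rw [lintegral_prod_mul (hF1 x).aemeasurable (hF1 x).aemeasurable]
          rw [ENNReal.rpow_two, sq]
      _ = ∫⁻ p : β × β, ∫⁻ x, F x p.1 * F x p.2 ∂μ ∂(ν.prod ν) := by
          rw [lintegral_lintegral_swap]
          apply Measurable.aemeasurable
          apply Measurable.mul
          · exact hF.comp (measurable_fst.prodMk (measurable_fst.comp measurable_snd))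
          · exact hF.comp (measurable_fst.prodMk (measurable_snd.comp measurable_snd))
      _ ≤ ∫⁻ p : β × β, N p.1 * N p.2 ∂(ν.prod ν) := by
          apply lintegral_mono
          intro p
          exact ENNReal.lintegral_mul_le_Lp_mul_Lq μ (Real.HolderConjugate.two_two) (hF2 p.1).aemeasurable (hF2 p.2).aemeasurable
      _ = (∫⁻ y, N y ∂ν) ^ (2:ℝ) := by
          rw [lintegral_prod_mul hNm.aemeasurable hNm.aemeasurable, ENNReal.rpow_two, sq]
  calc _ ≤ ((∫⁻ y, N y ∂ν) ^ (2:ℝ)) ^ ((1:ℝ)/2) := by gcongr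
    _ = _ := by rw [← ENNReal.rpow_mul]; norm_num

lemma as_even (F : ℝ → ℝ≥0∞) : ∫⁻ t : ℝ, F |t| = 2 * ∫⁻ t in Ioi 0, F t := by
  rw [← lintegral_add_compl _ (measurableSet_Ioi (a := (0:ℝ))), two_mul]
  congr 1
  · apply setLIntegral_congr_fun measurableSet_Ioi
    intro t ht; simp only; rw [abs_of_pos ht]
  · rw [compl_Ioi, ← lintegral_indicator measurableSet_Iic,
      ← lintegral_neg_eq_self ((Iic (0:ℝ)).indicator fun a => F |a|)]
    have : (fun x : ℝ => (Iic (0:ℝ)).indicator (fun a => F |a|) (-x)) = (Ici (0:ℝ)).indicator F := by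
      ext x
      by_cases hx : 0 ≤ x
      · simp [indicator, hx, abs_of_nonneg hx]
      · simp [indicator, hx]
    rw [this, lintegral_indicator measurableSet_Ici, setLIntegral_congr Ioi_ae_eq_Ici]

lemma as_int_small (b R : ℝ) (hb : 0 < b) (hR : 0 < R) :
    ∫⁻ t in Ioo 0 R, ENNReal.ofReal t ^ (b - 1) = ENNReal.ofReal (R ^ b / b) := by
  have h1 : ∫⁻ t in Ioo 0 R, ENNReal.ofReal t ^ (b - 1) = ∫⁻ t in Ioo 0 R, ENNReal.ofReal (t ^ (b - 1)) := by
    apply setLIntegral_congr_fun measurableSet_Ioo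
    intro t ht; simp only; rw [ENNReal.ofReal_rpow_of_pos ht.1]
  rw [h1, setLIntegral_congr Ioo_ae_eq_Ioc, ← ofReal_integral_eq_lintegral_ofReal, ← intervalIntegral.integral_of_le hR.le, integral_rpow]
  · congr 1; rw [Real.zero_rpow (by linarith)]; simp
  · left; linarith
  · have := intervalIntegral.intervalIntegrable_rpow' (a := 0) (b := R) (r := b - 1) (by linarith)
    rwa [intervalIntegrable_iff_integrableOn_Ioc_of_le hR.le] at this
  · filter_upwards [ae_restrict_mem measurableSet_Ioc] with t ht
    exact Real.rpow_nonneg ht.1.le _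

lemma as_int_large (c R : ℝ) (hc : c < -1) (hR : 0 < R) :
    ∫⁻ t in Ioi R, ENNReal.ofReal t ^ c = ENNReal.ofReal (- R ^ (c + 1) / (c + 1)) := by
  have h1 : ∫⁻ t in Ioi R, ENNReal.ofReal t ^ c = ∫⁻ t in Ioi R, ENNReal.ofReal (t ^ c) := by
    apply setLIntegral_congr_fun measurableSet_Ioi
    intro t ht; simp only; rw [ENNReal.ofReal_rpow_of_pos (hR.trans ht)]
  rw [h1, ← ofReal_integral_eq_lintegral_ofReal, integral_Ioi_rpow_of_lt hc hR]
  · exact integrableOn_Ioi_rpow_of_lt hc hR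
  · filter_upwards [ae_restrict_mem measurableSet_Ioi] with t ht
    exact Real.rpow_nonneg (hR.trans ht).le _

/-- truncated kernel -/
def kerT (b R : ℝ) (t : ℝ) : ℝ≥0∞ := if |t| < R then ENNReal.ofReal |t| ^ (b - 1) else 0

lemma kerT_meas (b R : ℝ) : Measurable (kerT b R) := by
  unfold kerT
  apply Measurable.ite _ _ measurable_const
  · exact measurableSet_lt (by fun_prop) (by fun_prop)
  · exact Measurable.pow_const (by fun_prop) _

lemma kerT_int (b R : ℝ) (hb : 0 < b) (hR : 0 < R) : ∫⁻ t, kerT b R t = ENNReal.ofReal (2 / b * R ^ b) := by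
  unfold kerT
  rw [as_even (fun t => if t < R then ENNReal.ofReal t ^ (b - 1) else 0)]
  have : ∫⁻ t in Ioi 0, (if t < R then ENNReal.ofReal t ^ (b - 1) else 0) = ∫⁻ t in Ioo 0 R, ENNReal.ofReal t ^ (b - 1) := by
    rw [← Ioi_inter_Iio, inter_comm, ← Measure.restrict_restrict measurableSet_Iio, ← lintegral_indicator measurableSet_Iio]
    rfl
  rw [this, as_int_small b R hb hR, ← ENNReal.ofReal_ofNat, ← ENNReal.ofReal_mul (by norm_num)]
  congr 1; ring

def kerL (c R : ℝ) (t : ℝ) : ℝ≥0∞ := if R ≤ |t| then ENNReal.ofReal |t| ^ c else 0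

lemma kerL_meas (b R : ℝ) : Measurable (kerL b R) := by
  unfold kerL
  apply Measurable.ite _ _ measurable_const
  · exact measurableSet_le (by fun_prop) (by fun_prop)
  · exact Measurable.pow_const (by fun_prop) _

lemma kerL_int (c R : ℝ) (hc : c < -1) (hR : 0 < R) : ∫⁻ t, kerL c R t = ENNReal.ofReal (2 / (-(c+1)) * R ^ (c+1)) := by
  unfold kerL
  rw [as_even (fun t => if R ≤ t then ENNReal.ofReal t ^ c else 0)]
  have : ∫⁻ t in Ioi 0, (if R ≤ t then ENNReal.ofReal t ^ c else 0) = ∫⁻ t in Ioi R, ENNReal.ofReal t ^ c := by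
    rw [setLIntegral_congr (Ioi_ae_eq_Ici (a := R)), show Ici R = Ici R ∩ Ioi 0 from (inter_eq_left.2 fun x hx => lt_of_lt_of_le hR hx).symm, ← Measure.restrict_restrict measurableSet_Ici, ← lintegral_indicator measurableSet_Ici]
    rfl
  rw [this, as_int_large c R hc hR, ← ENNReal.ofReal_ofNat, ← ENNReal.ofReal_mul (by norm_num)]
  congr 1
  have : c + 1 ≠ 0 := by linarith
  field_simp

lemma as_layer (q : ℝ) (hq : 0 < q) (u : ℝ≥0∞) :
    u ^ q ≤ ENNReal.ofReal q * ∫⁻ l in Ioi (0:ℝ), (if ENNReal.ofReal l < u then ENNReal.ofReal l ^ (q - 1) else 0) := by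
  have hfin : ∀ r : ℝ, 0 < r → ENNReal.ofReal r ≤ u → ENNReal.ofReal r ^ q ≤ ENNReal.ofReal q * ∫⁻ l in Ioi (0:ℝ), (if ENNReal.ofReal l < u then ENNReal.ofReal l ^ (q - 1) else 0) := by
    intro r hr hru
    have : ∫⁻ t in Ioo 0 r, ENNReal.ofReal t ^ (q - 1) ≤ ∫⁻ l in Ioi (0:ℝ), (if ENNReal.ofReal l < u then ENNReal.ofReal l ^ (q - 1) else 0) := by
      rw [← Ioi_inter_Iio, inter_comm, ← Measure.restrict_restrict measurableSet_Iio, ← lintegral_indicator measurableSet_Iio]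
      apply lintegral_mono
      intro t
      by_cases ht : t < r
      · have : ENNReal.ofReal t < u := lt_of_lt_of_le ((ENNReal.ofReal_lt_ofReal_iff hr).2 ht) hru
        simp [indicator, ht, this]
      · simp [indicator, ht]
    refine le_trans ?_ (mul_le_mul_right this _)
    rw [as_int_small q r hq hr, ← ENNReal.ofReal_mul hq.le, ENNReal.ofReal_rpow_of_pos hr]
    apply le_of_eq; congr 1; field_simp
  rcases eq_or_ne u 0 with rfl | hu0
  · rw [ENNReal.zero_rpow_of_pos hq]; exact zero_le
  rcases eq_or_ne u ⊤ with rfl | hut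
  · rw [ENNReal.top_rpow_of_pos hq]
    have : Tendsto (fun r : ℝ => ENNReal.ofReal r ^ q) atTop (nhds (⊤ ^ q)) :=
      ((ENNReal.continuous_rpow_const).tendsto _).comp ENNReal.tendsto_ofReal_atTop
    rw [ENNReal.top_rpow_of_pos hq] at this
    refine le_of_tendsto this ?_
    filter_upwards [eventually_gt_atTop 0] with r hr
    exact hfin r hr le_top
  · have := hfin u.toReal (ENNReal.toReal_pos hu0 hut) (by rw [ENNReal.ofReal_toReal hut])
    rwa [ENNReal.ofReal_toReal hut] at this

lemma ker_split (a R t : ℝ) : ENNReal.ofReal |t| ^ (a - 1) = kerT a R t + kerL (a - 1) R t := by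
  unfold kerT kerL
  by_cases h : |t| < R
  · simp [h, not_le.2 h]
  · simp [h, not_lt.1 h]

lemma as_dist (q a K : ℝ) (hq : 2 < q) (ha : a = 1/2 - 1/q) (hK : K = (4 * Real.sqrt q) ^ q) (l : ℝ) (hl : 0 < l)
    (h : ℝ → ℝ≥0∞) (hm : Measurable h) (hh : ∫⁻ y, h y ^ (2:ℝ) ≤ 1) :
    volume {x : ℝ | ENNReal.ofReal l < ∫⁻ y, ENNReal.ofReal |x - y| ^ (a - 1) * h y} ≤
      ENNReal.ofReal (4 * K ^ a / a * l ^ (-(q/2))) *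
       ∫⁻ y, (if ENNReal.ofReal (a / (8 * K ^ a) * l ^ (q/2)) < h y then h y else 0) := by
  have hq0 : 0 < q := by linarith
  have ha0 : 0 < a := by
    rw [ha, sub_pos]; exact one_div_lt_one_div_of_lt (by norm_num) hq
  have hK0 : 0 < K := by rw [hK]; positivity
  have hqa : q * a = q / 2 - 1 := by rw [ha]; field_simp
  set R : ℝ := K * l ^ (-q) with hR
  have hR0 : 0 < R := by positivity
  have hRa : R ^ a = K ^ a * l ^ (1 - q/2) := by
    rw [hR, Real.mul_rpow hK0.le (by positivity), ← Real.rpow_mul hl.le]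
    congr 2; linarith
  set s : ℝ := a / (8 * K ^ a) * l ^ (q/2) with hs
  have hs0 : 0 < s := by positivity
  set hb : ℝ → ℝ≥0∞ := fun y => if ENNReal.ofReal s < h y then h y else 0 with hhb
  have hbm : Measurable hb := Measurable.ite (measurableSet_lt measurable_const hm) hm measurable_const
  have hsub : ∀ x : ℝ, Measurable (fun y : ℝ => x - y) := fun x => by fun_prop
  have hT : ∀ x : ℝ, Measurable (fun y : ℝ => kerT a R (x - y)) := fun x => (kerT_meas a R).comp (hsub x)
  have hLm : ∀ x : ℝ, Measurable (fun y : ℝ => kerL (a - 1) R (x - y)) := fun x => (kerL_meas (a - 1) R).comp (hsub x)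
  have e2 : ∀ x : ℝ, ∫⁻ y, kerT a R (x - y) * ENNReal.ofReal s ≤ ENNReal.ofReal (l / 4) := by
    intro x
    rw [lintegral_mul_const _ (hT x), lintegral_sub_left_eq_self (kerT a R) x, kerT_int a R ha0 hR0, ← ENNReal.ofReal_mul (by positivity)]
    apply le_of_eq; congr 1
    rw [hRa, hs]
    have : l ^ (1 - q/2) * l ^ (q/2) = l := by rw [← Real.rpow_add hl]; simp
    calc 2 / a * (K ^ a * l ^ (1 - q/2)) * (a / (8 * K ^ a) * l ^ (q/2))
        = (l ^ (1 - q/2) * l ^ (q/2)) * (2 / a * K ^ a * (a / (8 * K ^ a))) := by ring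
      _ = l / 4 := by rw [this]; field_simp; norm_num
  have e3 : ∀ x : ℝ, ∫⁻ y, kerL (a - 1) R (x - y) * h y ≤ ENNReal.ofReal (l / 4) := by
    intro x
    refine (ENNReal.lintegral_mul_le_Lp_mul_Lq volume (Real.HolderConjugate.two_two) (hLm x).aemeasurable hm.aemeasurable).trans ?_
    have i1 : ∫⁻ y, kerL (a - 1) R (x - y) ^ (2:ℝ) = ENNReal.ofReal (q * R ^ (-(2/q))) := by
      rw [lintegral_sub_left_eq_self (fun t => kerL (a - 1) R t ^ (2:ℝ)) x]
      have : ∀ t, kerL (a - 1) R t ^ (2:ℝ) = kerL ((a - 1) * 2) R t := by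
        intro t; unfold kerL; split_ifs
        · rw [← ENNReal.rpow_mul]
        · simp
      simp_rw [this]
      have e : (a - 1) * 2 + 1 = -(2/q) := by rw [ha]; ring
      have : 0 < 2 / q := by positivity
      rw [kerL_int _ R (by linarith) hR0, e]
      congr 2; field_simp
    rw [i1]
    calc _ ≤ ENNReal.ofReal (q * R ^ (-(2/q))) ^ ((1:ℝ)/2) * 1 ^ ((1:ℝ)/2) := by gcongr
      _ = ENNReal.ofReal (l / 4) := by
        rw [ENNReal.one_rpow, mul_one, ENNReal.ofReal_rpow_of_pos (by positivity)]
        congr 1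
        rw [Real.mul_rpow hq0.le (by positivity), ← Real.rpow_mul hR0.le, ← Real.sqrt_eq_rpow,
          hR, Real.mul_rpow hK0.le (by positivity), ← Real.rpow_mul hl.le, hK, ← Real.rpow_mul (by positivity)]
        have e1 : q * (-(2/q) * (1/2)) = -1 := by field_simp
        have e2 : -q * (-(2/q) * (1/2)) = 1 := by field_simp
        rw [e1, e2, Real.rpow_one, Real.rpow_neg_one]
        field_simp
  have hsum : ∀ x : ℝ, ∫⁻ y, ENNReal.ofReal |x - y| ^ (a - 1) * h y ≤ (∫⁻ y, kerT a R (x - y) * hb y) + ENNReal.ofReal (l / 2) := by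
    intro x
    calc _ ≤ ∫⁻ y, (kerT a R (x - y) * hb y + kerT a R (x - y) * ENNReal.ofReal s) + kerL (a - 1) R (x - y) * h y := by
          apply lintegral_mono; intro y
          simp only
          rw [ker_split a R, add_mul, ← mul_add]
          gcongr
          simp only [hhb]
          split_ifs with hc
          · exact le_self_add
          · rw [zero_add]; exact not_lt.1 hc
      _ = _ := by
          rw [lintegral_add_left, lintegral_add_left]
          · exact (hT x).mul hbm
          · exact ((hT x).mul hbm).add ((hT x).mul_const _)
      _ ≤ (∫⁻ y, kerT a R (x - y) * hb y) + ENNReal.ofReal (l / 4) + ENNReal.ofReal (l / 4) := by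
          gcongr
          · exact e2 x
          · exact e3 x
      _ = _ := by
          rw [add_assoc, ← ENNReal.ofReal_add (by positivity) (by positivity)]
          congr 2; ring
  have hmm : Measurable (Function.uncurry fun x y : ℝ => kerT a R (x - y) * hb y) :=
    ((kerT_meas a R).comp (measurable_fst.sub measurable_snd)).mul (hbm.comp measurable_snd)
  have hsubset : {x : ℝ | ENNReal.ofReal l < ∫⁻ y, ENNReal.ofReal |x - y| ^ (a - 1) * h y} ⊆
      {x | ENNReal.ofReal (l/2) ≤ ∫⁻ y, kerT a R (x - y) * hb y} := by
    intro x hx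
    simp only [mem_ofPred_eq] at hx ⊢
    have := hx.trans_le (hsum x)
    rw [show ENNReal.ofReal l = ENNReal.ofReal (l/2) + ENNReal.ofReal (l/2) by
      rw [← ENNReal.ofReal_add (by positivity) (by positivity)]; congr 1; ring] at this
    exact (lt_of_add_lt_add_right this).le
  refine (measure_mono hsubset).trans ?_
  refine (meas_ge_le_lintegral_div hmm.lintegral_prod_right'.aemeasurable (by simpa using hl) ENNReal.ofReal_ne_top).trans ?_
  simp only [Function.uncurry_apply_pair]
  rw [lintegral_lintegral_swap hmm.aemeasurable]
  have : ∀ y, ∫⁻ x, kerT a R (x - y) * hb y = ENNReal.ofReal (2 / a * R ^ a) * hb y := by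
    intro y
    rw [lintegral_mul_const _ (show Measurable (fun x : ℝ => kerT a R (x - y)) from (kerT_meas a R).comp (by fun_prop)), lintegral_sub_right_eq_self (kerT a R) y, kerT_int a R ha0 hR0]
  simp_rw [this]
  rw [lintegral_const_mul _ hbm, mul_comm, mul_div_assoc, ← ENNReal.ofReal_div_of_pos (by positivity), mul_comm]
  gcongr
  apply le_of_eq
  rw [hRa, show (1 - q/2) = 1 + -(q/2) by ring, Real.rpow_add hl, Real.rpow_one]
  field_simp
  norm_num

lemma as_hls (q a : ℝ) (hq : 2 < q) (ha : a = 1/2 - 1/q) : ∃ C : ℝ, 0 < C ∧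
    ∀ h : ℝ → ℝ≥0∞, Measurable h → ∫⁻ y, h y ^ (2:ℝ) ≤ 1 →
    ∫⁻ x : ℝ, (∫⁻ y, ENNReal.ofReal |x - y| ^ (a - 1) * h y) ^ q ≤ ENNReal.ofReal C := by
  obtain ⟨K, hK⟩ : ∃ K, K = (4 * Real.sqrt q) ^ q := ⟨_, rfl⟩
  have hq0 : 0 < q := by linarith
  have ha0 : 0 < a := by
    rw [ha, sub_pos]; exact one_div_lt_one_div_of_lt (by norm_num) hq
  have hK0 : 0 < K := by rw [hK]; positivity
  set A := 4 * K ^ a / a with hA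
  set c := a / (8 * K ^ a) with hc
  have hA0 : 0 < A := by positivity
  have hc0 : 0 < c := by positivity
  refine ⟨q * (A * (2 / q * c⁻¹)), by positivity, ?_⟩
  intro h hm hh
  set I : ℝ → ℝ≥0∞ := fun x => ∫⁻ y, ENNReal.ofReal |x - y| ^ (a - 1) * h y with hI
  have hIm : Measurable I := by
    apply Measurable.lintegral_prod_right' (f := fun p : ℝ × ℝ => ENNReal.ofReal |p.1 - p.2| ^ (a - 1) * h p.2)
    exact (Measurable.pow_const (by fun_prop) _).mul (hm.comp measurable_snd)
  have inner : ∀ u : ℝ≥0∞, ∫⁻ l in Ioi (0:ℝ), (if ENNReal.ofReal (c * l ^ (q/2)) < u then ENNReal.ofReal l ^ (q/2 - 1) * u else 0) ≤ ENNReal.ofReal (2 / q * c⁻¹) * u ^ (2:ℝ) := by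
    intro u
    rcases eq_or_ne u 0 with rfl | hu0
    · simp
    rcases eq_or_ne u ⊤ with rfl | hut
    · rw [ENNReal.top_rpow_of_pos (by norm_num), ENNReal.mul_top]
      · exact le_top
      · simp; positivity
    obtain ⟨r, hr, rfl⟩ : ∃ r : ℝ, 0 < r ∧ u = ENNReal.ofReal r := ⟨u.toReal, ENNReal.toReal_pos hu0 hut, (ENNReal.ofReal_toReal hut).symm⟩
    set L := (r / c) ^ (2/q) with hL
    have hL0 : 0 < L := by positivity
    calc _ ≤ ∫⁻ l in Ioi (0:ℝ), (Iio L).indicator (fun l => ENNReal.ofReal l ^ (q/2 - 1) * ENNReal.ofReal r) l := by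
          apply setLIntegral_mono_ae'
          · exact measurableSet_Ioi
          refine Eventually.of_forall ?_
          intro l hl
          have hl : 0 < l := hl
          split_ifs with hcl
          · have : l < L := by
              rw [ENNReal.ofReal_lt_ofReal_iff hr] at hcl
              have h1 : l ^ (q/2) < r / c := by rw [lt_div_iff₀ hc0]; linarith
              have h2 := Real.rpow_lt_rpow (by positivity) h1 (show 0 < 2/q by positivity)
              rwa [← Real.rpow_mul hl.le, show q/2*(2/q) = 1 by field_simp, Real.rpow_one] at h2
            simp [indicator, this]
          · exact zero_le
      _ = (∫⁻ l in Ioo 0 L, ENNReal.ofReal l ^ (q/2 - 1)) * ENNReal.ofReal r := by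
          rw [lintegral_indicator measurableSet_Iio, Measure.restrict_restrict measurableSet_Iio, inter_comm, Ioi_inter_Iio, lintegral_mul_const']
          exact ENNReal.ofReal_ne_top
      _ = _ := by
          rw [as_int_small (q/2) L (by positivity) hL0, hL, ← Real.rpow_mul (by positivity), show 2/q*(q/2) = 1 by field_simp, Real.rpow_one,
            ENNReal.rpow_two, sq, ← ENNReal.ofReal_mul (by positivity), ← ENNReal.ofReal_mul (by positivity), ← ENNReal.ofReal_mul (by positivity)]
          congr 1; field_simp
  calc ∫⁻ x, I x ^ q ≤ ∫⁻ x, ENNReal.ofReal q * ∫⁻ l in Ioi (0:ℝ), (if ENNReal.ofReal l < I x then ENNReal.ofReal l ^ (q - 1) else 0) :=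
        lintegral_mono fun x => as_layer q hq0 (I x)
    _ = ENNReal.ofReal q * ∫⁻ x, ∫⁻ l in Ioi (0:ℝ), (if ENNReal.ofReal l < I x then ENNReal.ofReal l ^ (q - 1) else 0) := by
        rw [lintegral_const_mul' _ _ ENNReal.ofReal_ne_top]
    _ = ENNReal.ofReal q * ∫⁻ l in Ioi (0:ℝ), ∫⁻ x, (if ENNReal.ofReal l < I x then ENNReal.ofReal l ^ (q - 1) else 0) := by
        rw [lintegral_lintegral_swap]
        apply Measurable.aemeasurable
        apply Measurable.ite _ _ measurable_const
        · exact measurableSet_lt (by fun_prop) (hIm.comp measurable_fst)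
        · exact Measurable.pow_const (by fun_prop) _
    _ ≤ ENNReal.ofReal q * ∫⁻ l in Ioi (0:ℝ), ENNReal.ofReal A * ∫⁻ y, (if ENNReal.ofReal (c * l ^ (q/2)) < h y then ENNReal.ofReal l ^ (q/2 - 1) * h y else 0) := by
        gcongr 1
        apply setLIntegral_mono_ae'
        · exact measurableSet_Ioi
        refine Eventually.of_forall ?_
        intro l hl
        have hl : 0 < l := hl
        have := as_dist q a K hq ha hK l hl h hm hh
        rw [← hA, ← hc] at this
        calc ∫⁻ x, (if ENNReal.ofReal l < I x then ENNReal.ofReal l ^ (q - 1) else 0) 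
            = ENNReal.ofReal l ^ (q - 1) * volume {x | ENNReal.ofReal l < I x} := by
              rw [← lintegral_indicator_const (measurableSet_lt measurable_const hIm)]
              congr 1; ext x; simp [indicator]
          _ ≤ ENNReal.ofReal l ^ (q - 1) * (ENNReal.ofReal (A * l ^ (-(q/2))) * ∫⁻ y, (if ENNReal.ofReal (c * l ^ (q/2)) < h y then h y else 0)) := by
              gcongr
          _ = ENNReal.ofReal A * (ENNReal.ofReal l ^ (q/2 - 1) * ∫⁻ y, (if ENNReal.ofReal (c * l ^ (q/2)) < h y then h y else 0)) := by
              rw [← mul_assoc, ← mul_assoc]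
              congr 1
              rw [ENNReal.ofReal_rpow_of_pos hl, ENNReal.ofReal_rpow_of_pos hl, ← ENNReal.ofReal_mul (by positivity), ← ENNReal.ofReal_mul (by positivity)]
              congr 1
              rw [mul_left_comm, ← Real.rpow_add hl]
              congr 2; ring
          _ = _ := by
              rw [← lintegral_const_mul']
              · congr 2; ext y; split_ifs <;> simp
              · rw [ENNReal.ofReal_rpow_of_pos hl]; exact ENNReal.ofReal_ne_top
    _ = ENNReal.ofReal q * (ENNReal.ofReal A * ∫⁻ y, ∫⁻ l in Ioi (0:ℝ), (if ENNReal.ofReal (c * l ^ (q/2)) < h y then ENNReal.ofReal l ^ (q/2 - 1) * h y else 0)) := by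
        rw [lintegral_const_mul' _ _ ENNReal.ofReal_ne_top, lintegral_lintegral_swap]
        apply Measurable.aemeasurable
        apply Measurable.ite _ _ measurable_const
        · exact measurableSet_lt (by fun_prop) (hm.comp measurable_snd)
        · exact (Measurable.pow_const (by fun_prop) _).mul (hm.comp measurable_snd)
    _ ≤ ENNReal.ofReal q * (ENNReal.ofReal A * ∫⁻ y, ENNReal.ofReal (2 / q * c⁻¹) * h y ^ (2:ℝ)) := by
        gcongr with y
        exact inner (h y)
    _ ≤ ENNReal.ofReal q * (ENNReal.ofReal A * (ENNReal.ofReal (2 / q * c⁻¹) * 1)) := by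
        rw [lintegral_const_mul' _ _ ENNReal.ofReal_ne_top]
        gcongr
    _ = _ := by
        rw [mul_one, ← ENNReal.ofReal_mul (by positivity), ← ENNReal.ofReal_mul (by positivity)]

lemma as_cm {α : Type*} [MeasurableSpace α] (μ : Measure α) (c : ℝ≥0∞) (w : α → ℝ≥0∞) (hw : Measurable w) :
    (∫⁻ x, (c * w x) ^ (2:ℝ) ∂μ) ^ ((1:ℝ)/2) = c * (∫⁻ x, w x ^ (2:ℝ) ∂μ) ^ ((1:ℝ)/2) := by
  simp_rw [ENNReal.mul_rpow_of_nonneg _ _ (show (0:ℝ) ≤ 2 by norm_num)]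
  rw [lintegral_const_mul _ (hw.pow_const _), ENNReal.mul_rpow_of_nonneg _ _ (by norm_num), ← ENNReal.rpow_mul]
  norm_num

/-- boundedness of convolution with k from L^2 to L^q -/
def OpB (q : ℝ) (k : ℝ → ℝ≥0∞) (N : ℝ≥0∞) : Prop :=
  ∀ h : ℝ → ℝ≥0∞, Measurable h →
    (∫⁻ x : ℝ, (∫⁻ y, k (x - y) * h y) ^ q) ^ (1/q) ≤ N * (∫⁻ y, h y ^ (2:ℝ)) ^ ((1:ℝ)/2)

lemma as_hls2 (q a : ℝ) (hq : 2 < q) (ha : a = 1/2 - 1/q) : ∃ C : ℝ, 0 < C ∧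
    OpB q (fun t => ENNReal.ofReal |t| ^ (a - 1)) (ENNReal.ofReal C) := by
  obtain ⟨C, hC, H⟩ := as_hls q a hq ha
  have hq0 : 0 < q := by linarith
  refine ⟨C ^ (1/q), by positivity, ?_⟩
  intro h hm
  have hkm : ∀ x, Measurable fun y : ℝ => ENNReal.ofReal |x - y| ^ (a - 1) :=
    fun x => Measurable.pow_const (by fun_prop) _
  set A := (∫⁻ y, h y ^ (2:ℝ)) ^ ((1:ℝ)/2) with hA
  have hA2 : ∫⁻ y, h y ^ (2:ℝ) = A ^ (2:ℝ) := by rw [hA, ← ENNReal.rpow_mul]; norm_num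
  rcases eq_or_ne A 0 with h0 | h0
  · have hz : h =ᵐ[volume] 0 := by
      rw [h0, ENNReal.zero_rpow_of_pos (by norm_num), lintegral_eq_zero_iff (hm.pow_const _)] at hA2
      filter_upwards [hA2] with y hy
      simpa using hy
    have : ∀ x, ∫⁻ y, ENNReal.ofReal |x - y| ^ (a - 1) * h y = 0 := by
      intro x
      rw [lintegral_eq_zero_iff (show Measurable fun y => ENNReal.ofReal |x - y| ^ (a - 1) * h y from (hkm x).mul hm)]
      filter_upwards [hz] with y hy
      simp [hy]
    simp_rw [this]
    rw [ENNReal.zero_rpow_of_pos hq0]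
    simp [hq0]
  rcases eq_or_ne A ⊤ with ht | ht
  · rw [ht, ENNReal.mul_top]
    · exact le_top
    · simp; positivity
  have hiA : A⁻¹ ≠ ⊤ := ENNReal.inv_ne_top.2 h0
  have h1 := H (fun y => A⁻¹ * h y) (hm.const_mul _) (by
    simp_rw [ENNReal.mul_rpow_of_nonneg _ _ (show (0:ℝ) ≤ 2 by norm_num)]
    rw [lintegral_const_mul _ (hm.pow_const _), hA2, ← ENNReal.mul_rpow_of_nonneg _ _ (by norm_num), ENNReal.inv_mul_cancel h0 ht]
    simp)
  have h2 : ∀ x, ∫⁻ y, ENNReal.ofReal |x - y| ^ (a - 1) * (A⁻¹ * h y) = A⁻¹ * ∫⁻ y, ENNReal.ofReal |x - y| ^ (a - 1) * h y := by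
    intro x
    rw [← lintegral_const_mul' _ _ hiA]
    congr 1; ext y; ring
  simp_rw [h2, ENNReal.mul_rpow_of_nonneg _ _ hq0.le] at h1
  rw [lintegral_const_mul' _ _ (ENNReal.rpow_ne_top_of_nonneg hq0.le hiA)] at h1
  have h3 := ENNReal.rpow_le_rpow h1 (show 0 ≤ 1/q by positivity)
  rw [ENNReal.mul_rpow_of_nonneg _ _ (by positivity), ← ENNReal.rpow_mul, mul_one_div_cancel hq0.ne', ENNReal.rpow_one,
    ENNReal.ofReal_rpow_of_pos hC] at h3
  calc _ = A * (A⁻¹ * (∫⁻ x : ℝ, (∫⁻ y, ENNReal.ofReal |x - y| ^ (a - 1) * h y) ^ q) ^ (1/q)) := by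
        rw [← mul_assoc, ENNReal.mul_inv_cancel h0 ht, one_mul]
    _ ≤ A * ENNReal.ofReal (C ^ (1/q)) := by gcongr
    _ = _ := mul_comm _ _

lemma as_op (q a b : ℝ) (hq : 2 ≤ q) (ha : a = 1/2 - 1/q) (hb : 0 < b) (hab : a ≤ b) : ∃ C : ℝ, 0 < C ∧
    ∀ R : ℝ, 0 < R → OpB q (kerT b R) (ENNReal.ofReal (C * R ^ (b - a))) := by
  have hq0 : 0 < q := by linarith
  rcases eq_or_lt_of_le hq with h2 | h2
  · subst h2
    refine ⟨2 / b, by positivity, ?_⟩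
    intro R hR h hm
    have ha0 : a = 0 := by rw [ha]; norm_num
    rw [ha0, sub_zero, ← kerT_int b R hb hR]
    have e : ∀ x, ∫⁻ y, kerT b R (x - y) * h y = ∫⁻ t, kerT b R t * h (x - t) := by
      intro x
      rw [← lintegral_sub_left_eq_self (fun t => kerT b R t * h (x - t)) x]
      simp
    simp_rw [e]
    refine (as_mink volume volume (fun x t => kerT b R t * h (x - t)) ?_).trans ?_
    · exact ((kerT_meas b R).comp measurable_snd).mul (hm.comp (measurable_fst.sub measurable_snd))
    rw [← lintegral_mul_const _ (kerT_meas b R)]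
    apply lintegral_mono
    intro t
    simp only
    rw [as_cm volume _ (fun x => h (x - t)) (hm.comp (by fun_prop)), lintegral_sub_right_eq_self (fun t => h t ^ (2:ℝ)) t]
  · obtain ⟨C, hC, H⟩ := as_hls2 q a h2 ha
    refine ⟨C, hC, ?_⟩
    intro R hR h hm
    have hk : ∀ t, kerT b R t ≤ ENNReal.ofReal (R ^ (b - a)) * ENNReal.ofReal |t| ^ (a - 1) := by
      intro t
      unfold kerT
      split_ifs with ht
      · rcases eq_or_ne t 0 with rfl | h0
        · have ha1 : a < 1 := by
            have : 0 < 1 / q := by positivity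
            linarith
          rw [abs_zero, ENNReal.ofReal_zero, ENNReal.zero_rpow_of_neg (show a - 1 < 0 by linarith), ENNReal.mul_top]
          · exact le_top
          · simp; positivity
        · have h0 : 0 < |t| := abs_pos.2 h0
          rw [ENNReal.ofReal_rpow_of_pos h0, ENNReal.ofReal_rpow_of_pos h0, ← ENNReal.ofReal_mul (by positivity)]
          apply ENNReal.ofReal_le_ofReal
          rw [show b - 1 = (b - a) + (a - 1) by ring, Real.rpow_add h0]
          gcongr
      · exact zero_le
    have hRt : ENNReal.ofReal (R ^ (b - a)) ≠ ⊤ := ENNReal.ofReal_ne_top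
    calc _ ≤ (∫⁻ x : ℝ, (∫⁻ y, ENNReal.ofReal (R ^ (b - a)) * (ENNReal.ofReal |x - y| ^ (a - 1) * h y)) ^ q) ^ (1/q) := by
          gcongr ?_ ^ (1/q)
          refine lintegral_mono fun x => ?_
          gcongr ?_ ^ q
          refine lintegral_mono fun y => ?_
          rw [← mul_assoc]
          exact mul_le_mul_left (hk _) _
      _ = ENNReal.ofReal (R ^ (b - a)) * (∫⁻ x : ℝ, (∫⁻ y, (ENNReal.ofReal |x - y| ^ (a - 1) * h y)) ^ q) ^ (1/q) := by
          simp_rw [lintegral_const_mul' _ _ hRt, ENNReal.mul_rpow_of_nonneg _ _ hq0.le]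
          rw [lintegral_const_mul' _ _ (ENNReal.rpow_ne_top_of_nonneg hq0.le hRt), ENNReal.mul_rpow_of_nonneg _ _ (by positivity),
            ← ENNReal.rpow_mul, mul_one_div_cancel hq0.ne', ENNReal.rpow_one]
      _ ≤ ENNReal.ofReal (R ^ (b - a)) * (ENNReal.ofReal C * (∫⁻ y, h y ^ (2:ℝ)) ^ ((1:ℝ)/2)) := by
          gcongr
          exact H h hm
      _ = _ := by
          rw [← mul_assoc, ← ENNReal.ofReal_mul (by positivity), mul_comm (R ^ (b - a))]

/-- mixed norm -/
def mixN (q1 q2 q3 : ℝ) (u : ℝ → ℝ → ℝ → ℝ≥0∞) : ℝ≥0∞ :=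
  (∫⁻ x3 : ℝ, ((∫⁻ x2 : ℝ, ((∫⁻ x1 : ℝ, u x1 x2 x3 ^ q1) ^ (1/q1)) ^ q2) ^ (1/q2)) ^ q3) ^ (1/q3)

lemma as_three (q1 q2 q3 : ℝ) (hq1 : 0 < q1) (hq2 : 0 < q2) (hq3 : 0 < q3) (k1 k2 k3 : ℝ → ℝ≥0∞) (N1 N2 N3 : ℝ≥0∞)
    (hN1 : N1 ≠ ⊤) (hN2 : N2 ≠ ⊤) (hk2 : Measurable k2) (hk3 : Measurable k3)
    (H1 : OpB q1 k1 N1) (H2 : OpB q2 k2 N2) (H3 : OpB q3 k3 N3)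
    (g : ℝ × ℝ × ℝ → ℝ≥0∞) (hg : Measurable g) :
    mixN q1 q2 q3 (fun x1 x2 x3 => ∫⁻ y1, k1 (x1 - y1) * ∫⁻ y2, k2 (x2 - y2) * ∫⁻ y3, k3 (x3 - y3) * g (y1, y2, y3))
      ≤ N1 * N2 * N3 * (∫⁻ y, g y ^ (2:ℝ)) ^ ((1:ℝ)/2) := by
  -- inner function
  set W : ℝ → ℝ → ℝ → ℝ≥0∞ := fun x3 y1 y2 => ∫⁻ y3, k3 (x3 - y3) * g (y1, y2, y3) with hW
  have hWm : ∀ x3, Measurable (fun p : ℝ × ℝ => W x3 p.1 p.2) := by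
    intro x3
    apply Measurable.lintegral_prod_right' (f := fun p : (ℝ × ℝ) × ℝ => k3 (x3 - p.2) * g (p.1.1, p.1.2, p.2))
    exact (hk3.comp (by fun_prop)).mul (hg.comp (by fun_prop))
  set Hh : ℝ → ℝ → ℝ≥0∞ := fun x3 y2 => (∫⁻ y1, W x3 y1 y2 ^ (2:ℝ)) ^ ((1:ℝ)/2) with hH
  have hHm : ∀ x3, Measurable (Hh x3) := by
    intro x3
    apply Measurable.pow_const
    apply Measurable.lintegral_prod_left' (f := fun p : ℝ × ℝ => W x3 p.1 p.2 ^ (2:ℝ))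
    exact (hWm x3).pow_const _
  set G : ℝ → ℝ≥0∞ := fun y3 => (∫⁻ p : ℝ × ℝ, g (p.1, p.2, y3) ^ (2:ℝ)) ^ ((1:ℝ)/2) with hG
  have hGm : Measurable G := by
    apply Measurable.pow_const
    apply Measurable.lintegral_prod_left' (f := fun p : (ℝ × ℝ) × ℝ => g (p.1.1, p.1.2, p.2) ^ (2:ℝ))
    exact (hg.comp (by fun_prop)).pow_const _
  have s1 : ∀ x3 x2, (∫⁻ x1 : ℝ, (∫⁻ y1, k1 (x1 - y1) * ∫⁻ y2, k2 (x2 - y2) * W x3 y1 y2) ^ q1) ^ (1/q1)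
      ≤ N1 * ∫⁻ y2, k2 (x2 - y2) * Hh x3 y2 := by
    intro x3 x2
    have hm : Measurable (fun p : ℝ × ℝ => k2 (x2 - p.2) * W x3 p.1 p.2) := (hk2.comp (by fun_prop)).mul (hWm x3)
    refine (H1 (fun y1 => ∫⁻ y2, k2 (x2 - y2) * W x3 y1 y2) hm.lintegral_prod_right').trans ?_
    gcongr
    refine (as_mink volume volume (fun y1 y2 => k2 (x2 - y2) * W x3 y1 y2) hm).trans ?_
    apply lintegral_mono
    intro y2
    simp only
    rw [as_cm volume _ (fun y1 => W x3 y1 y2) ((hWm x3).comp (show Measurable fun y1 : ℝ => (y1, y2) by fun_prop))]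
  have s2 : ∀ x3, (∫⁻ x2, (N1 * ∫⁻ y2, k2 (x2 - y2) * Hh x3 y2) ^ q2) ^ (1/q2) ≤ N1 * N2 * ∫⁻ y3, k3 (x3 - y3) * G y3 := by
    intro x3
    simp_rw [ENNReal.mul_rpow_of_nonneg _ _ hq2.le]
    rw [lintegral_const_mul' _ _ (ENNReal.rpow_ne_top_of_nonneg hq2.le hN1), ENNReal.mul_rpow_of_nonneg _ _ (by positivity),
            ← ENNReal.rpow_mul, mul_one_div_cancel hq2.ne', ENNReal.rpow_one, mul_assoc]
    gcongr
    refine (H2 (Hh x3) (hHm x3)).trans ?_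
    gcongr
    have e : ∫⁻ y2, Hh x3 y2 ^ (2:ℝ) = ∫⁻ p : ℝ × ℝ, W x3 p.1 p.2 ^ (2:ℝ) := by
      rw [Measure.volume_eq_prod, lintegral_prod_symm' _ ((hWm x3).pow_const _)]
      congr 1; ext y2
      simp only [hH]
      rw [← ENNReal.rpow_mul]; norm_num
    rw [e]
    have hm : Measurable (fun p : (ℝ × ℝ) × ℝ => k3 (x3 - p.2) * g (p.1.1, p.1.2, p.2)) := (hk3.comp (by fun_prop)).mul (hg.comp (by fun_prop))
    refine (as_mink volume volume (fun (p : ℝ × ℝ) y3 => k3 (x3 - y3) * g (p.1, p.2, y3)) hm).trans ?_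
    apply lintegral_mono
    intro y3
    simp only
    rw [as_cm volume _ (fun p : ℝ × ℝ => g (p.1, p.2, y3)) (hg.comp (by fun_prop))]
  have s3 : (∫⁻ x3, (N1 * N2 * ∫⁻ y3, k3 (x3 - y3) * G y3) ^ q3) ^ (1/q3) ≤ N1 * N2 * (N3 * (∫⁻ y, g y ^ (2:ℝ)) ^ ((1:ℝ)/2)) := by
    simp_rw [ENNReal.mul_rpow_of_nonneg _ _ hq3.le]
    rw [lintegral_const_mul' _ _ (ENNReal.mul_ne_top (ENNReal.rpow_ne_top_of_nonneg hq3.le hN1) (ENNReal.rpow_ne_top_of_nonneg hq3.le hN2)),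
      ← ENNReal.mul_rpow_of_nonneg _ _ hq3.le, ENNReal.mul_rpow_of_nonneg _ _ (by positivity),
            ← ENNReal.rpow_mul, mul_one_div_cancel hq3.ne', ENNReal.rpow_one]
    gcongr
    refine (H3 G hGm).trans ?_
    gcongr
    apply le_of_eq
    have e1 : ∀ y3, G y3 ^ (2:ℝ) = ∫⁻ y1, ∫⁻ y2, g (y1, y2, y3) ^ (2:ℝ) := by
      intro y3
      simp only [hG]
      rw [← ENNReal.rpow_mul, Measure.volume_eq_prod, lintegral_prod (fun p : ℝ × ℝ => g (p.1, p.2, y3) ^ (2:ℝ)) ((hg.comp (by fun_prop)).pow_const _).aemeasurable]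
      norm_num
    simp_rw [e1]
    rw [lintegral_lintegral_swap]
    · rw [Measure.volume_eq_prod, lintegral_prod _ (hg.pow_const _).aemeasurable]
      congr 1; ext y1
      rw [Measure.volume_eq_prod, lintegral_prod_symm' (fun p : ℝ × ℝ => g (y1, p) ^ (2:ℝ)) ((hg.comp (by fun_prop)).pow_const _)]
    · apply Measurable.aemeasurable
      apply Measurable.lintegral_prod_right' (f := fun p : (ℝ × ℝ) × ℝ => g (p.1.2, p.2, p.1.1) ^ (2:ℝ))
      exact (hg.comp (by fun_prop)).pow_const _
  unfold mixN
  calc _ ≤ (∫⁻ x3 : ℝ, ((∫⁻ x2 : ℝ, (N1 * ∫⁻ y2, k2 (x2 - y2) * Hh x3 y2) ^ q2) ^ (1/q2)) ^ q3) ^ (1/q3) := by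
        gcongr with x3 x2
        exact s1 x3 x2
    _ ≤ (∫⁻ x3 : ℝ, (N1 * N2 * ∫⁻ y3, k3 (x3 - y3) * G y3) ^ q3) ^ (1/q3) := by
        gcongr with x3
        exact s2 x3
    _ ≤ _ := by rw [mul_assoc (N1 * N2)]; exact s3

lemma as_scale (t : ℝ) (ht : 0 < t) (Φ : E3 → ℝ≥0∞) (hΦ : Measurable Φ) :
    ∫⁻ z, Φ (t • z) = ENNReal.ofReal t ^ (-(3:ℝ)) * ∫⁻ y, Φ y := by
  have h1 := Measure.map_addHaar_smul (volume : Measure E3) ht.ne'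
  have h2 : ∫⁻ z, Φ (t • z) = ∫⁻ y, Φ y ∂(Measure.map (t • ·) (volume : Measure E3)) := by
    rw [lintegral_map hΦ (measurable_const_smul t)]
  rw [h2, h1, lintegral_smul_measure]
  simp only [finrank_euclideanSpace, Fintype.card_fin, smul_eq_mul]
  congr 1
  rw [ENNReal.ofReal_rpow_of_pos ht, abs_of_pos (by positivity), Real.rpow_neg ht.le]
  norm_cast

lemma as_rep_inner (R : ℝ) (hR : 0 < R) (r : ℝ) (hr : 0 ≤ r) :
    ∫⁻ t in Ioo (0:ℝ) 1, (if r < t * R then ENNReal.ofReal t ^ (-(3:ℝ)) else 0) ≤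
      if r < R then ENNReal.ofReal (R ^ 2 / 2) * ENNReal.ofReal r ^ (-(2:ℝ)) else 0 := by
  split_ifs with h
  · rcases eq_or_lt_of_le hr with h0 | h0
    · rw [← h0, ENNReal.ofReal_zero, ENNReal.zero_rpow_of_neg (by norm_num), ENNReal.mul_top]
      · exact le_top
      · simp; positivity
    have hrR : 0 < r / R := by positivity
    calc _ ≤ ∫⁻ t in Ioo (0:ℝ) 1, (Ioi (r/R)).indicator (fun t => ENNReal.ofReal t ^ (-(3:ℝ))) t := by
          apply lintegral_mono
          intro t
          have : r < t * R ↔ r / R < t := by rw [div_lt_iff₀ hR]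
          simp [indicator, this]
      _ ≤ ∫⁻ t, (Ioi (r/R)).indicator (fun t => ENNReal.ofReal t ^ (-(3:ℝ))) t := setLIntegral_le_lintegral _ _
      _ = _ := by
          rw [lintegral_indicator measurableSet_Ioi, as_int_large _ _ (by norm_num) hrR, ENNReal.ofReal_rpow_of_pos h0, ← ENNReal.ofReal_mul (by positivity)]
          congr 1
          rw [show (-3 + 1 : ℝ) = -2 by norm_num, Real.rpow_neg hrR.le, Real.rpow_neg hr]
          rw [Real.rpow_two, Real.rpow_two]
          field_simp
  · apply le_of_eq
    rw [setLIntegral_congr_fun (g := fun _ => 0) measurableSet_Ioo, lintegral_zero]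
    intro t ht
    simp only
    rw [if_neg]
    nlinarith [ht.1, ht.2]

lemma as_rep_pt (f : E3 → ℝ) (hf : ContDiff ℝ 1 f) (x z : E3) :
    ENNReal.ofReal |f x| ≤ ENNReal.ofReal |f (x + z)| +
      ∫⁻ t in Ioo (0:ℝ) 1, ENNReal.ofReal ‖z‖ * ENNReal.ofReal ‖fderiv ℝ f (x + t • z)‖ := by
  have hd : ∀ t ∈ uIcc (0:ℝ) 1, HasDerivAt (fun t : ℝ => f (x + t • z)) (fderiv ℝ f (x + t • z) z) t := by
    intro t _
    have h1 : HasFDerivAt f (fderiv ℝ f (x + t • z)) (x + t • z) := (hf.differentiable one_ne_zero _).hasFDerivAt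
    have h2 : HasDerivAt (fun t : ℝ => x + t • z) z t := by
      simpa using ((hasDerivAt_id t).smul_const z).const_add x
    exact h1.comp_hasDerivAt t h2
  have hc : Continuous (fun t : ℝ => fderiv ℝ f (x + t • z) z) := by
    have := hf.continuous_fderiv one_ne_zero
    exact (this.comp (by fun_prop)).clm_apply continuous_const
  have h := intervalIntegral.integral_eq_sub_of_hasDerivAt hd (hc.intervalIntegrable _ _)
  simp only [one_smul, zero_smul, add_zero] at h
  rw [intervalIntegral.integral_of_le zero_le_one] at h
  have h3 : ENNReal.ofReal |f (x + z) - f x| ≤ ∫⁻ t in Ioo (0:ℝ) 1, ENNReal.ofReal ‖z‖ * ENNReal.ofReal ‖fderiv ℝ f (x + t • z)‖ := by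
    rw [← h, ← Real.norm_eq_abs, ofReal_norm]
    refine (enorm_integral_le_lintegral_enorm _).trans ?_
    rw [setLIntegral_congr Ioo_ae_eq_Ioc]
    apply lintegral_mono
    intro t
    simp only
    rw [← ofReal_norm, ← ENNReal.ofReal_mul (norm_nonneg _), mul_comm]
    exact ENNReal.ofReal_le_ofReal (ContinuousLinearMap.le_opNorm _ _)
  calc ENNReal.ofReal |f x| ≤ ENNReal.ofReal (|f (x + z)| + |f (x + z) - f x|) := by
        apply ENNReal.ofReal_le_ofReal
        have := abs_sub_abs_le_abs_sub (f x) (f (x + z))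
        rw [abs_sub_comm] at this
        linarith
    _ = ENNReal.ofReal |f (x + z)| + ENNReal.ofReal |f (x + z) - f x| := ENNReal.ofReal_add (abs_nonneg _) (abs_nonneg _)
    _ ≤ _ := by gcongr

lemma as_rep (f : E3 → ℝ) (hf : ContDiff ℝ 1 f) (x : E3) (R : ℝ) (hR : 0 < R) :
    ENNReal.ofReal |f x| * (ENNReal.ofReal (R ^ 3) * volume (ball (0:E3) 1)) ≤
      (∫⁻ z, if ‖z‖ < R then ENNReal.ofReal |f (x + z)| else 0) +
      ENNReal.ofReal (R ^ 3 / 2) * ∫⁻ y, if ‖y‖ < R then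
        ENNReal.ofReal ‖y‖ ^ (-(2:ℝ)) * ENNReal.ofReal ‖fderiv ℝ f (x + y)‖ else 0 := by
  have hgc : Continuous (fun y => ‖fderiv ℝ f y‖) := (hf.continuous_fderiv one_ne_zero).norm
  set g : E3 → ℝ≥0∞ := fun y => ENNReal.ofReal ‖fderiv ℝ f y‖ with hg
  have hgm : Measurable g := hgc.measurable.ennreal_ofReal
  have hfm : Measurable f := hf.continuous.measurable
  have hs : MeasurableSet {z : E3 | ‖z‖ < R} := measurableSet_lt measurable_norm measurable_const
  have hvol : volume (ball (0:E3) R) = ENNReal.ofReal (R ^ 3) * volume (ball (0:E3) 1) := by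
    have := Measure.addHaar_ball (volume : Measure E3) 0 hR.le
    simpa using this
  have e1 : ENNReal.ofReal |f x| * volume (ball (0:E3) R) = ∫⁻ z : E3, if ‖z‖ < R then ENNReal.ofReal |f x| else 0 := by
    rw [← lintegral_indicator_const measurableSet_ball]
    congr 1; ext z; simp [indicator]
  rw [← hvol, e1]
  calc ∫⁻ z : E3, (if ‖z‖ < R then ENNReal.ofReal |f x| else 0) ≤
      ∫⁻ z : E3, ((if ‖z‖ < R then ENNReal.ofReal |f (x + z)| else 0) +
        ENNReal.ofReal R * ∫⁻ t in Ioo (0:ℝ) 1, (if ‖z‖ < R then g (x + t • z) else 0)) := by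
        apply lintegral_mono
        intro z
        simp only
        split_ifs with hz
        · refine (as_rep_pt f hf x z).trans ?_
          gcongr
          rw [lintegral_const_mul' _ _ ENNReal.ofReal_ne_top]
          gcongr
        · exact zero_le
    _ = (∫⁻ z, if ‖z‖ < R then ENNReal.ofReal |f (x + z)| else 0) +
        ENNReal.ofReal R * ∫⁻ z : E3, ∫⁻ t in Ioo (0:ℝ) 1, (if ‖z‖ < R then g (x + t • z) else 0) := by
        rw [lintegral_add_left, lintegral_const_mul' _ _ ENNReal.ofReal_ne_top]
        exact Measurable.ite hs (hfm.comp (by fun_prop)).abs.ennreal_ofReal measurable_const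
    _ = (∫⁻ z, if ‖z‖ < R then ENNReal.ofReal |f (x + z)| else 0) +
        ENNReal.ofReal R * ∫⁻ t in Ioo (0:ℝ) 1, ∫⁻ z : E3, (if ‖z‖ < R then g (x + t • z) else 0) := by
        rw [lintegral_lintegral_swap]
        apply Measurable.aemeasurable
        apply Measurable.ite _ _ measurable_const
        · exact measurableSet_lt (by fun_prop) measurable_const
        · exact hgm.comp (by fun_prop)
    _ = (∫⁻ z, if ‖z‖ < R then ENNReal.ofReal |f (x + z)| else 0) +
        ENNReal.ofReal R * ∫⁻ t in Ioo (0:ℝ) 1, ∫⁻ y : E3, (if ‖y‖ < t * R then ENNReal.ofReal t ^ (-(3:ℝ)) else 0) * g (x + y) := by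
        congr 2
        apply setLIntegral_congr_fun measurableSet_Ioo
        intro t ht
        have ht0 : 0 < t := ht.1
        have := as_scale t ht0 (fun y => if ‖y‖ < t * R then g (x + y) else 0) (by
          apply Measurable.ite _ _ measurable_const
          · exact measurableSet_lt (by fun_prop) measurable_const
          · exact hgm.comp (by fun_prop))
        simp only [norm_smul, Real.norm_eq_abs, abs_of_pos ht0, mul_lt_mul_iff_right₀ ht0] at this
        simp only
        rw [this, ← lintegral_const_mul']
        · congr 1; ext y; split_ifs <;> simp
        · rw [ENNReal.ofReal_rpow_of_pos ht0]; exact ENNReal.ofReal_ne_top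
    _ = (∫⁻ z, if ‖z‖ < R then ENNReal.ofReal |f (x + z)| else 0) +
        ENNReal.ofReal R * ∫⁻ y : E3, ∫⁻ t in Ioo (0:ℝ) 1, (if ‖y‖ < t * R then ENNReal.ofReal t ^ (-(3:ℝ)) else 0) * g (x + y) := by
        rw [lintegral_lintegral_swap]
        apply Measurable.aemeasurable
        apply Measurable.mul
        · apply Measurable.ite _ _ measurable_const
          · exact measurableSet_lt (by fun_prop) (by fun_prop)
          · exact Measurable.pow_const (by fun_prop) _
        · exact hgm.comp (by fun_prop)
    _ ≤ (∫⁻ z, if ‖z‖ < R then ENNReal.ofReal |f (x + z)| else 0) +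
        ENNReal.ofReal R * ∫⁻ y : E3, ENNReal.ofReal (R ^ 2 / 2) * (if ‖y‖ < R then
        ENNReal.ofReal ‖y‖ ^ (-(2:ℝ)) * g (x + y) else 0) := by
        gcongr with y
        rw [lintegral_mul_const' _ _ ENNReal.ofReal_ne_top]
        refine (mul_le_mul_left (as_rep_inner R hR ‖y‖ (norm_nonneg _)) _).trans (le_of_eq ?_)
        split_ifs
        · rw [mul_assoc]
        · simp
    _ = _ := by
        rw [lintegral_const_mul' _ _ ENNReal.ofReal_ne_top, ← mul_assoc, ← ENNReal.ofReal_mul hR.le]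
        congr 3; ring

lemma as_pt3_mp : MeasurePreserving (fun p : ℝ × ℝ × ℝ => pt3 p.1 p.2.1 p.2.2) volume volume := by
  have h1 := (EuclideanSpace.volume_preserving_symm_measurableEquiv_toLp (Fin 3)).symm
  have h2 := (volume_preserving_piFinSuccAbove (fun _ : Fin 3 => ℝ) 0).symm
  have h3 := (volume_preserving_finTwoArrow ℝ).symm
  have h4 := (MeasurePreserving.id (volume : Measure ℝ)).prod h3
  have h5 := h1.comp (h2.comp h4)
  have e : (fun p : ℝ × ℝ × ℝ => pt3 p.1 p.2.1 p.2.2) = (⇑(MeasurableEquiv.toLp 2 (Fin 3 → ℝ)).symm.symm ∘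
      ⇑(MeasurableEquiv.piFinSuccAbove (fun _ : Fin 3 => ℝ) 0).symm ∘ Prod.map id ⇑(MeasurableEquiv.finTwoArrow (α := ℝ)).symm) := by
    funext p
    refine PiLp.ext fun i => ?_
    fin_cases i <;> rfl
  rw [e]
  exact h5

lemma as_pt3_lint (F : E3 → ℝ≥0∞) (hF : Measurable F) :
    ∫⁻ y, F y = ∫⁻ p : ℝ × ℝ × ℝ, F (pt3 p.1 p.2.1 p.2.2) :=
  (as_pt3_mp.lintegral_comp hF).symm

lemma mixN_mono (q1 q2 q3 : ℝ) (hq1 : 0 < q1) (hq2 : 0 < q2) (hq3 : 0 < q3) (u v : ℝ → ℝ → ℝ → ℝ≥0∞)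
    (h : ∀ x1 x2 x3, u x1 x2 x3 ≤ v x1 x2 x3) : mixN q1 q2 q3 u ≤ mixN q1 q2 q3 v := by
  unfold mixN
  gcongr with x3 x2 x1
  exact h x1 x2 x3

lemma lp_const (q : ℝ) (hq : 0 < q) (c : ℝ≥0∞) (hc : c ≠ ⊤) (w : ℝ → ℝ≥0∞) :
    (∫⁻ x, (c * w x) ^ q) ^ (1/q) = c * (∫⁻ x, w x ^ q) ^ (1/q) := by
  simp_rw [ENNReal.mul_rpow_of_nonneg _ _ hq.le]
  rw [lintegral_const_mul' _ _ (ENNReal.rpow_ne_top_of_nonneg hq.le hc), ENNReal.mul_rpow_of_nonneg _ _ (by positivity),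
    ← ENNReal.rpow_mul, mul_one_div_cancel hq.ne', ENNReal.rpow_one]

lemma mixN_const (q1 q2 q3 : ℝ) (hq1 : 0 < q1) (hq2 : 0 < q2) (hq3 : 0 < q3) (c : ℝ≥0∞) (hc : c ≠ ⊤) (u : ℝ → ℝ → ℝ → ℝ≥0∞) :
    mixN q1 q2 q3 (fun x1 x2 x3 => c * u x1 x2 x3) = c * mixN q1 q2 q3 u := by
  unfold mixN
  simp_rw [lp_const q1 hq1 c hc, lp_const q2 hq2 c hc, lp_const q3 hq3 c hc]

lemma mixN_add (q1 q2 q3 : ℝ) (hq1 : 1 ≤ q1) (hq2 : 1 ≤ q2) (hq3 : 1 ≤ q3) (u v : ℝ → ℝ → ℝ → ℝ≥0∞)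
    (hu : Measurable fun p : ℝ × ℝ × ℝ => u p.1 p.2.1 p.2.2) (hv : Measurable fun p : ℝ × ℝ × ℝ => v p.1 p.2.1 p.2.2) :
    mixN q1 q2 q3 (fun x1 x2 x3 => u x1 x2 x3 + v x1 x2 x3) ≤ mixN q1 q2 q3 u + mixN q1 q2 q3 v := by
  have m1 : ∀ w : ℝ → ℝ → ℝ → ℝ≥0∞, (Measurable fun p : ℝ × ℝ × ℝ => w p.1 p.2.1 p.2.2) →
      Measurable fun p : ℝ × ℝ => (∫⁻ x1 : ℝ, w x1 p.1 p.2 ^ q1) ^ (1/q1) := by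
    intro w hw
    apply Measurable.pow_const
    apply Measurable.lintegral_prod_left' (f := fun p : ℝ × ℝ × ℝ => w p.1 p.2.1 p.2.2 ^ q1)
    exact hw.pow_const _
  have m2 : ∀ w : ℝ → ℝ → ℝ → ℝ≥0∞, (Measurable fun p : ℝ × ℝ × ℝ => w p.1 p.2.1 p.2.2) →
      Measurable fun x3 : ℝ => (∫⁻ x2 : ℝ, ((∫⁻ x1 : ℝ, w x1 x2 x3 ^ q1) ^ (1/q1)) ^ q2) ^ (1/q2) := by
    intro w hw
    apply Measurable.pow_const
    apply Measurable.lintegral_prod_left' (f := fun p : ℝ × ℝ => ((∫⁻ x1 : ℝ, w x1 p.1 p.2 ^ q1) ^ (1/q1)) ^ q2)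
    exact (m1 w hw).pow_const _
  have m0 : ∀ w : ℝ → ℝ → ℝ → ℝ≥0∞, (Measurable fun p : ℝ × ℝ × ℝ => w p.1 p.2.1 p.2.2) → ∀ x2 x3,
      Measurable fun x1 => w x1 x2 x3 := by
    intro w hw x2 x3
    exact hw.comp (show Measurable fun x1 : ℝ => (x1, x2, x3) by fun_prop)
  have m1' : ∀ w : ℝ → ℝ → ℝ → ℝ≥0∞, (Measurable fun p : ℝ × ℝ × ℝ => w p.1 p.2.1 p.2.2) → ∀ x3,
      Measurable fun x2 => (∫⁻ x1 : ℝ, w x1 x2 x3 ^ q1) ^ (1/q1) := by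
    intro w hw x3
    exact (m1 w hw).comp (show Measurable fun x2 : ℝ => (x2, x3) by fun_prop)
  have p1 : 0 < q1 := by linarith
  have p2 : 0 < q2 := by linarith
  have p3 : 0 < q3 := by linarith
  unfold mixN
  refine le_trans ?_ (ENNReal.lintegral_Lp_add_le (m2 u hu).aemeasurable (m2 v hv).aemeasurable hq3)
  gcongr with x3
  refine le_trans ?_ (ENNReal.lintegral_Lp_add_le (m1' u hu x3).aemeasurable (m1' v hv x3).aemeasurable hq2)
  gcongr with x2
  exact ENNReal.lintegral_Lp_add_le (m0 u hu x2 x3).aemeasurable (m0 v hv x2 x3).aemeasurable hq1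

/-- triple convolution -/
def T3 (k1 k2 k3 : ℝ → ℝ≥0∞) (g : ℝ × ℝ × ℝ → ℝ≥0∞) (x1 x2 x3 : ℝ) : ℝ≥0∞ :=
  ∫⁻ p : ℝ × ℝ × ℝ, k1 (x1 - p.1) * (k2 (x2 - p.2.1) * (k3 (x3 - p.2.2) * g p))

lemma T3_meas (k1 k2 k3 : ℝ → ℝ≥0∞) (g : ℝ × ℝ × ℝ → ℝ≥0∞) (h1 : Measurable k1) (h2 : Measurable k2) (h3 : Measurable k3)
    (hg : Measurable g) : Measurable fun p : ℝ × ℝ × ℝ => T3 k1 k2 k3 g p.1 p.2.1 p.2.2 := by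
  unfold T3
  apply Measurable.lintegral_prod_right' (f := fun r : (ℝ × ℝ × ℝ) × (ℝ × ℝ × ℝ) =>
    k1 (r.1.1 - r.2.1) * (k2 (r.1.2.1 - r.2.2.1) * (k3 (r.1.2.2 - r.2.2.2) * g r.2)))
  exact (h1.comp (by fun_prop)).mul ((h2.comp (by fun_prop)).mul ((h3.comp (by fun_prop)).mul (hg.comp (by fun_prop))))

lemma T3_eq (k1 k2 k3 : ℝ → ℝ≥0∞) (g : ℝ × ℝ × ℝ → ℝ≥0∞) (h1 : Measurable k1) (h2 : Measurable k2) (h3 : Measurable k3)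
    (hg : Measurable g) (x1 x2 x3 : ℝ) : T3 k1 k2 k3 g x1 x2 x3 =
    ∫⁻ y1, k1 (x1 - y1) * ∫⁻ y2, k2 (x2 - y2) * ∫⁻ y3, k3 (x3 - y3) * g (y1, y2, y3) := by
  unfold T3
  have hm3 : Measurable fun p : ℝ × ℝ × ℝ => k3 (x3 - p.2.2) * g p := (h3.comp (by fun_prop)).mul hg
  have hm2 : Measurable fun p : ℝ × ℝ × ℝ => k2 (x2 - p.2.1) * (k3 (x3 - p.2.2) * g p) := (h2.comp (by fun_prop)).mul hm3
  have hm1 : Measurable fun p : ℝ × ℝ × ℝ => k1 (x1 - p.1) * (k2 (x2 - p.2.1) * (k3 (x3 - p.2.2) * g p)) :=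
    (h1.comp (by fun_prop)).mul hm2
  rw [Measure.volume_eq_prod, lintegral_prod _ hm1.aemeasurable]
  congr 1; ext y1
  simp only
  have a1 : Measurable fun p : ℝ × ℝ => k2 (x2 - p.1) * (k3 (x3 - p.2) * g (y1, p)) := hm2.comp (show Measurable fun p : ℝ × ℝ => (y1, p) by fun_prop)
  rw [lintegral_const_mul _ a1, Measure.volume_eq_prod, lintegral_prod _ a1.aemeasurable]
  congr 2; ext y2
  simp only
  rw [lintegral_const_mul _ (show Measurable fun y3 => k3 (x3 - y3) * g (y1, y2, y3) from hm3.comp (show Measurable fun y3 : ℝ => (y1, y2, y3) by fun_prop))]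

lemma as_T3 (q1 q2 q3 a1 a2 a3 b1 b2 b3 : ℝ) (hq1 : 2 ≤ q1) (hq2 : 2 ≤ q2) (hq3 : 2 ≤ q3)
    (ha1 : a1 = 1/2 - 1/q1) (ha2 : a2 = 1/2 - 1/q2) (ha3 : a3 = 1/2 - 1/q3)
    (hb1 : 0 < b1) (hb2 : 0 < b2) (hb3 : 0 < b3) (hab1 : a1 ≤ b1) (hab2 : a2 ≤ b2) (hab3 : a3 ≤ b3) :
    ∃ C : ℝ, 0 < C ∧ ∀ R : ℝ, 0 < R → ∀ g : ℝ × ℝ × ℝ → ℝ≥0∞, Measurable g →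
      mixN q1 q2 q3 (T3 (kerT b1 R) (kerT b2 R) (kerT b3 R) g) ≤
        ENNReal.ofReal (C * R ^ (b1 + b2 + b3 - (a1 + a2 + a3))) * (∫⁻ y, g y ^ (2:ℝ)) ^ ((1:ℝ)/2) := by
  obtain ⟨C1, hC1, H1⟩ := as_op q1 a1 b1 hq1 ha1 hb1 hab1
  obtain ⟨C2, hC2, H2⟩ := as_op q2 a2 b2 hq2 ha2 hb2 hab2
  obtain ⟨C3, hC3, H3⟩ := as_op q3 a3 b3 hq3 ha3 hb3 hab3
  refine ⟨C1 * C2 * C3, by positivity, ?_⟩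
  intro R hR g hg
  have := as_three q1 q2 q3 (by linarith) (by linarith) (by linarith) (kerT b1 R) (kerT b2 R) (kerT b3 R) _ _ _
    ENNReal.ofReal_ne_top ENNReal.ofReal_ne_top (kerT_meas b2 R) (kerT_meas b3 R) (H1 R hR) (H2 R hR) (H3 R hR) g hg
  have e : T3 (kerT b1 R) (kerT b2 R) (kerT b3 R) g = fun x1 x2 x3 => ∫⁻ y1, kerT b1 R (x1 - y1) * ∫⁻ y2, kerT b2 R (x2 - y2) * ∫⁻ y3, kerT b3 R (x3 - y3) * g (y1, y2, y3) := by
    funext x1 x2 x3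
    exact T3_eq _ _ _ g (kerT_meas b1 R) (kerT_meas b2 R) (kerT_meas b3 R) hg x1 x2 x3
  rw [e]
  refine this.trans (le_of_eq ?_)
  rw [← ENNReal.ofReal_mul (by positivity), ← ENNReal.ofReal_mul (by positivity)]
  congr 2
  rw [show b1 + b2 + b3 - (a1 + a2 + a3) = (b1 - a1) + (b2 - a2) + (b3 - a3) by ring, Real.rpow_add hR, Real.rpow_add hR]
  ring

lemma as_ker_bound (b1 b2 b3 s R : ℝ) (hb1 : b1 ≤ 1) (hb2 : b2 ≤ 1) (hb3 : b3 ≤ 1) (hs : s = (1 - b1) + (1 - b2) + (1 - b3))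
    (w : E3) (hw : ‖w‖ < R) :
    ENNReal.ofReal ‖w‖ ^ (-s) ≤ kerT b1 R (w 0) * (kerT b2 R (w 1) * kerT b3 R (w 2)) := by
  have hn : ∀ i, |w i| ≤ ‖w‖ := fun i => PiLp.norm_apply_le w i
  have hk : ∀ (b : ℝ) (i : Fin 3), b ≤ 1 → (ENNReal.ofReal ‖w‖)⁻¹ ^ (1 - b) ≤ kerT b R (w i) := by
    intro b i hb
    unfold kerT
    rw [if_pos (lt_of_le_of_lt (hn i) hw), show b - 1 = -(1 - b) by ring, ENNReal.rpow_neg, ← ENNReal.inv_rpow]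
    have : 0 ≤ 1 - b := by linarith
    gcongr
    exact hn i
  rw [ENNReal.rpow_neg, ← ENNReal.inv_rpow, hs, ENNReal.rpow_add_of_nonneg _ _ (by linarith) (by linarith),
    ENNReal.rpow_add_of_nonneg _ _ (by linarith) (by linarith), mul_assoc]
  gcongr
  · exact hk b1 0 hb1
  · exact hk b2 1 hb2
  · exact hk b3 2 hb3

lemma kerT_symm (b R s t : ℝ) : kerT b R (s - t) = kerT b R (t - s) := by
  unfold kerT; rw [abs_sub_comm]

lemma as_conv_bound (b1 b2 b3 s R : ℝ) (hb1 : b1 ≤ 1) (hb2 : b2 ≤ 1) (hb3 : b3 ≤ 1) (hs : s = (1 - b1) + (1 - b2) + (1 - b3))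
    (g : E3 → ℝ≥0∞) (hg : Measurable g) (x1 x2 x3 : ℝ) :
    ∫⁻ z : E3, (if ‖z‖ < R then ENNReal.ofReal ‖z‖ ^ (-s) * g (pt3 x1 x2 x3 + z) else 0) ≤
      T3 (kerT b1 R) (kerT b2 R) (kerT b3 R) (fun p => g (pt3 p.1 p.2.1 p.2.2)) x1 x2 x3 := by
  rw [← lintegral_sub_right_eq_self (fun z : E3 => if ‖z‖ < R then ENNReal.ofReal ‖z‖ ^ (-s) * g (pt3 x1 x2 x3 + z) else 0) (pt3 x1 x2 x3)]
  rw [as_pt3_lint]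
  · unfold T3
    apply lintegral_mono
    intro p
    simp only [add_sub_cancel]
    split_ifs with h
    · rw [← mul_assoc, ← mul_assoc]
      gcongr
      rw [mul_assoc]
      refine (as_ker_bound b1 b2 b3 s R hb1 hb2 hb3 hs _ h).trans (le_of_eq ?_)
      rw [kerT_symm b1 R x1, kerT_symm b2 R x2, kerT_symm b3 R x3]
      rfl
    · exact zero_le
  · apply Measurable.ite _ _ measurable_const
    · exact measurableSet_lt (by fun_prop) measurable_const
    · exact (Measurable.pow_const (by fun_prop) _).mul (hg.comp (by fun_prop))

lemma aniso_mixN (q1 q2 q3 : ℝ) (Ω : Set E3) (f : E3 → ℝ) :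
    anisoNorm q1 q2 q3 Ω f = mixN q1 q2 q3 (fun x1 x2 x3 => ENNReal.ofReal |Ω.indicator f (pt3 x1 x2 x3)|) := by
  unfold anisoNorm mixN
  simp_rw [← ENNReal.rpow_mul, one_div_mul_eq_div]

lemma l2On_eq (s : Set E3) (hs : MeasurableSet s) (g : E3 → ℝ) (hg : Measurable g) :
    (∫⁻ p : ℝ × ℝ × ℝ, (s.indicator (fun x => ENNReal.ofReal |g x|) (pt3 p.1 p.2.1 p.2.2)) ^ (2:ℝ)) ^ ((1:ℝ)/2) = l2On s g := by
  have hm : Measurable fun x => ENNReal.ofReal |g x| := by fun_prop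
  rw [← as_pt3_lint (fun y => (s.indicator (fun x => ENNReal.ofReal |g x|) y) ^ (2:ℝ)) ((hm.indicator hs).pow_const _)]
  unfold l2On
  rw [← lintegral_indicator hs]
  congr 2
  ext y
  by_cases h : y ∈ s <;> simp [h]

lemma pt3_meas : Measurable fun p : ℝ × ℝ × ℝ => pt3 p.1 p.2.1 p.2.2 := as_pt3_mp.measurable

lemma as_pointwise (b1 b2 b3 ρ η R : ℝ) (hb1 : b1 ≤ 1) (hb2 : b2 ≤ 1) (hb3 : b3 ≤ 1) (hb : b1 + b2 + b3 = 1)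
    (hR : 0 < R) (hρ : ρ + R ≤ η) (f : E3 → ℝ) (hf : ContDiff ℝ 1 f) (v : ℝ) (hv : 0 < v)
    (hV : volume (ball (0:E3) 1) = ENNReal.ofReal v) (x1 x2 x3 : ℝ) :
    ENNReal.ofReal |(ball (0:E3) ρ).indicator f (pt3 x1 x2 x3)| ≤
      ENNReal.ofReal (1 / (R^3 * v)) * T3 (kerT 1 R) (kerT 1 R) (kerT 1 R)
        (fun p => (ball (0:E3) η).indicator (fun x => ENNReal.ofReal |f x|) (pt3 p.1 p.2.1 p.2.2)) x1 x2 x3 +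
      ENNReal.ofReal (1 / (2 * v)) * T3 (kerT b1 R) (kerT b2 R) (kerT b3 R)
        (fun p => (ball (0:E3) η).indicator (fun x => ENNReal.ofReal |‖fderiv ℝ f x‖|) (pt3 p.1 p.2.1 p.2.2)) x1 x2 x3 := by
  by_cases hx : pt3 x1 x2 x3 ∈ ball (0:E3) ρ
  swap
  · rw [indicator_of_notMem hx]; simp
  rw [indicator_of_mem hx]
  set x := pt3 x1 x2 x3 with hxd
  have hfm : Measurable fun x => ENNReal.ofReal |f x| := by
    have := hf.continuous.measurable
    fun_prop
  have hgm : Measurable fun x => ENNReal.ofReal |‖fderiv ℝ f x‖| := by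
    have := (hf.continuous_fderiv one_ne_zero).measurable
    fun_prop
  have hin : ∀ z : E3, ‖z‖ < R → x + z ∈ ball (0:E3) η := by
    intro z hz
    rw [mem_ball_zero_iff] at hx ⊢
    linarith [norm_add_le x z]
  have c1 := as_conv_bound 1 1 1 0 R le_rfl le_rfl le_rfl (by norm_num) _ (hfm.indicator (measurableSet_ball (x := (0:E3)) (ε := η))) x1 x2 x3
  have c2 := as_conv_bound b1 b2 b3 2 R hb1 hb2 hb3 (by linarith) _ (hgm.indicator (measurableSet_ball (x := (0:E3)) (ε := η))) x1 x2 x3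
  have r := as_rep f hf x R hR
  have e1 : (∫⁻ z, if ‖z‖<R then ENNReal.ofReal |f (x+z)| else 0) = 
    ∫⁻ z : E3, (if ‖z‖ < R then ENNReal.ofReal ‖z‖ ^ (-(0:ℝ)) * (ball (0:E3) η).indicator (fun x => ENNReal.ofReal |f x|) (x + z) else 0) := by
    congr 1; ext z
    split_ifs with h
    · rw [indicator_of_mem (hin z h)]; simp
    · rfl
  have e2 : (∫⁻ y, if ‖y‖<R then ENNReal.ofReal ‖y‖ ^ (-(2:ℝ)) * ENNReal.ofReal ‖fderiv ℝ f (x+y)‖ else 0) = 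
    ∫⁻ z : E3, (if ‖z‖ < R then ENNReal.ofReal ‖z‖ ^ (-(2:ℝ)) * (ball (0:E3) η).indicator (fun x => ENNReal.ofReal |‖fderiv ℝ f x‖|) (x + z) else 0) := by
    congr 1; ext z
    split_ifs with h
    · rw [indicator_of_mem (hin z h), abs_norm]
    · rfl
  rw [e1, e2, hV, ← ENNReal.ofReal_mul (by positivity)] at r
  have r2 := r.trans (add_le_add c1 (mul_le_mul_right c2 _))
  have r3 := mul_le_mul_right r2 (ENNReal.ofReal (1 / (R^3*v)))
  rw [mul_add, ← mul_assoc, ← ENNReal.ofReal_mul (by positivity), ← ENNReal.ofReal_mul (by positivity),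
    ← mul_assoc _ (ENNReal.ofReal (R^3/2)), ← ENNReal.ofReal_mul (by positivity)] at r3
  rw [show 1 / (R^3*v) * |f x| * (R^3*v) = |f x| by field_simp, show 1 / (R^3*v) * (R^3/2) = 1 / (2*v) by field_simp] at r3
  exact r3

lemma as_main (q1 q2 q3 θ : ℝ) (hq1 : 2 ≤ q1) (hq2 : 2 ≤ q2) (hq3 : 2 ≤ q3)
    (hθ : θ = 3/2 - (1/q1 + 1/q2 + 1/q3)) (h0 : 0 ≤ θ) (h1 : θ ≤ 1) :
    ∃ C : ℝ, 0 < C ∧ ∀ ρ η R : ℝ, 0 < R → ρ + R ≤ η → ∀ f : E3 → ℝ, ContDiff ℝ 1 f →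
      anisoNorm q1 q2 q3 (ball (0:E3) ρ) f ≤
        ENNReal.ofReal (C * R ^ (1 - θ)) * l2On (ball (0:E3) η) (fun x => ‖fderiv ℝ f x‖)
        + ENNReal.ofReal (C * R ^ (-θ)) * l2On (ball (0:E3) η) f := by
  have i1 : 0 < 1/q1 ∧ 1/q1 ≤ 1/2 := ⟨by positivity, one_div_le_one_div_of_le (by norm_num) hq1⟩
  have i2 : 0 < 1/q2 ∧ 1/q2 ≤ 1/2 := ⟨by positivity, one_div_le_one_div_of_le (by norm_num) hq2⟩
  have i3 : 0 < 1/q3 ∧ 1/q3 ≤ 1/2 := ⟨by positivity, one_div_le_one_div_of_le (by norm_num) hq3⟩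
  obtain ⟨b1, hb1⟩ : ∃ b, b = (1/2 - 1/q1) + (1-θ)/3 := ⟨_, rfl⟩
  obtain ⟨b2, hb2⟩ : ∃ b, b = (1/2 - 1/q2) + (1-θ)/3 := ⟨_, rfl⟩
  obtain ⟨b3, hb3⟩ : ∃ b, b = (1/2 - 1/q3) + (1-θ)/3 := ⟨_, rfl⟩
  obtain ⟨A, hA, HA⟩ := as_T3 q1 q2 q3 _ _ _ 1 1 1 hq1 hq2 hq3 rfl rfl rfl one_pos one_pos one_pos
    (by linarith) (by linarith) (by linarith)
  have hb1p : 0 < b1 := by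
    rcases h1.lt_or_eq with h | h <;> linarith
  have hb2p : 0 < b2 := by
    rcases h1.lt_or_eq with h | h <;> linarith
  have hb3p : 0 < b3 := by
    rcases h1.lt_or_eq with h | h <;> linarith
  obtain ⟨B, hB, HB⟩ := as_T3 q1 q2 q3 _ _ _ b1 b2 b3 hq1 hq2 hq3 rfl rfl rfl hb1p hb2p hb3p
    (by linarith) (by linarith) (by linarith)
  obtain ⟨v, hvd⟩ : ∃ v, v = (volume (ball (0:E3) 1)).toReal := ⟨_, rfl⟩
  have hV : volume (ball (0:E3) 1) = ENNReal.ofReal v := by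
    rw [hvd, ENNReal.ofReal_toReal measure_ball_lt_top.ne]
  have hv : 0 < v := by
    rw [hvd]
    exact ENNReal.toReal_pos (measure_ball_pos volume _ one_pos).ne' measure_ball_lt_top.ne
  have hCA : A / v ≤ A / v + B / (2*v) := by
    have : 0 < B / (2*v) := by positivity
    linarith
  have hCB : B / (2*v) ≤ A / v + B / (2*v) := by
    have : 0 < A / v := by positivity
    linarith
  refine ⟨A / v + B / (2*v), by positivity, ?_⟩
  intro ρ η R hR hρ f hf
  have hfm : Measurable f := hf.continuous.measurable
  have hgm : Measurable fun x => ‖fderiv ℝ f x‖ := (hf.continuous_fderiv one_ne_zero).norm.measurable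
  have hF : Measurable fun p : ℝ × ℝ × ℝ => (ball (0:E3) η).indicator (fun x => ENNReal.ofReal |f x|) (pt3 p.1 p.2.1 p.2.2) := by
    have h : Measurable fun x => ENNReal.ofReal |f x| := by fun_prop
    exact (h.indicator measurableSet_ball).comp pt3_meas
  have hG : Measurable fun p : ℝ × ℝ × ℝ => (ball (0:E3) η).indicator (fun x => ENNReal.ofReal |‖fderiv ℝ f x‖|) (pt3 p.1 p.2.1 p.2.2) := by
    have h : Measurable fun x => ENNReal.ofReal |‖fderiv ℝ f x‖| := by fun_prop
    exact (h.indicator measurableSet_ball).comp pt3_meas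
  rw [aniso_mixN]
  have t1 := HA R hR _ hF
  have t2 := HB R hR _ hG
  rw [l2On_eq _ measurableSet_ball f hfm] at t1
  rw [l2On_eq _ measurableSet_ball (fun x => ‖fderiv ℝ f x‖) hgm] at t2
  refine (mixN_mono q1 q2 q3 (by linarith) (by linarith) (by linarith) _ _
    (as_pointwise b1 b2 b3 ρ η R (by linarith) (by linarith) (by linarith) (by linarith) hR hρ f hf v hv hV)).trans ?_
  refine (mixN_add q1 q2 q3 (by linarith) (by linarith) (by linarith) _ _
    ((T3_meas _ _ _ _ (kerT_meas 1 R) (kerT_meas 1 R) (kerT_meas 1 R) hF).const_mul _)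
    ((T3_meas _ _ _ _ (kerT_meas b1 R) (kerT_meas b2 R) (kerT_meas b3 R) hG).const_mul _)).trans ?_
  rw [mixN_const _ _ _ (by linarith) (by linarith) (by linarith) _ ENNReal.ofReal_ne_top,
    mixN_const _ _ _ (by linarith) (by linarith) (by linarith) _ ENNReal.ofReal_ne_top, add_comm]
  apply add_le_add
  · refine (mul_le_mul_right t2 _).trans ?_
    rw [← mul_assoc, ← ENNReal.ofReal_mul (by positivity)]
    refine mul_le_mul_left (ENNReal.ofReal_le_ofReal ?_) _
    rw [show b1 + b2 + b3 - (1/2 - 1/q1 + (1/2 - 1/q2) + (1/2 - 1/q3)) = 1 - θ by linarith]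
    calc _ = B / (2*v) * R ^ (1-θ) := by ring
      _ ≤ _ := mul_le_mul_of_nonneg_right hCB (by positivity)
  · refine (mul_le_mul_right t1 _).trans ?_
    rw [← mul_assoc, ← ENNReal.ofReal_mul (by positivity)]
    refine mul_le_mul_left (ENNReal.ofReal_le_ofReal ?_) _
    rw [show (1:ℝ) + 1 + 1 - (1/2 - 1/q1 + (1/2 - 1/q2) + (1/2 - 1/q3)) = 3 + -θ by linarith, Real.rpow_add hR]
    calc _ = A / v * R ^ (-θ) := by
          rw [show R ^ (3:ℝ) = R ^ 3 by norm_cast]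
          field_simp
      _ ≤ _ := mul_le_mul_of_nonneg_right hCA (by positivity)

lemma l2On_fin (η : ℝ) (g : E3 → ℝ) (hg : Continuous g) : l2On (ball (0:E3) η) g ≠ ⊤ := by
  obtain ⟨M, hM⟩ := (isCompact_closedBall (0:E3) η).exists_bound_of_continuousOn hg.continuousOn
  unfold l2On
  apply ENNReal.rpow_ne_top_of_nonneg (by norm_num)
  refine ne_of_lt (lt_of_le_of_lt (setLIntegral_mono (g := fun _ => (ENNReal.ofReal M)^2) measurable_const ?_) ?_)
  · intro x hx
    gcongr
    exact hM x (ball_subset_closedBall hx)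
  · rw [setLIntegral_const]
    exact ENNReal.mul_lt_top (by simp) measure_ball_lt_top

/-- optimisation over the radius -/
lemma as_opt (θ C δ D F : ℝ) (h0 : 0 ≤ θ) (h1 : θ ≤ 1) (hC : 0 < C) (hδ : 0 < δ) (hD : 0 ≤ D) (hF : 0 ≤ F) (L : ℝ≥0∞)
    (H : ∀ R, 0 < R → R ≤ δ → L ≤ ENNReal.ofReal (C * R ^ (1-θ) * D + C * R ^ (-θ) * F)) :
    L ≤ ENNReal.ofReal (2 * C * (D ^ θ * F ^ (1-θ)) + C * δ ^ (-θ) * F) := by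
  have P : 0 ≤ D ^ θ * F ^ (1-θ) := by positivity
  have Q : 0 ≤ C * δ ^ (-θ) * F := by positivity
  by_cases hc : D * δ ≤ F
  · refine (H δ hδ le_rfl).trans (ENNReal.ofReal_le_ofReal ?_)
    have : δ ^ (1-θ) * D ≤ D ^ θ * F ^ (1-θ) := by
      rcases hD.eq_or_lt with h | h
      · rw [← h] at P ⊢; simpa using P
      calc δ ^ (1-θ) * D = D ^ θ * (D * δ) ^ (1-θ) := by
            rw [Real.mul_rpow hD hδ.le, ← mul_assoc, ← Real.rpow_add h]
            simp [mul_comm]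
        _ ≤ _ := by gcongr
    nlinarith
  · push Not at hc
    have hDp : 0 < D := by
      by_contra h
      have : D = 0 := by linarith
      subst this; linarith
    rcases hF.eq_or_lt with h | h
    · subst h
      rcases h1.lt_or_eq with ht | ht
      · have lim : Tendsto (fun R : ℝ => ENNReal.ofReal (C * R ^ (1-θ) * D + C * R ^ (-θ) * 0)) (nhdsWithin 0 (Ioi 0)) (nhds 0) := by
          have : Tendsto (fun R : ℝ => ENNReal.ofReal (C * R ^ (1-θ) * D)) (nhds 0) (nhds (ENNReal.ofReal (C * 0 ^ (1-θ) * D))) := by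
            apply ENNReal.tendsto_ofReal
            exact ((Real.continuousAt_rpow_const 0 (1-θ) (Or.inr (by linarith))).tendsto.const_mul C).mul_const D
          rw [Real.zero_rpow (by linarith)] at this
          simpa using this.mono_left nhdsWithin_le_nhds
        refine (ge_of_tendsto lim ?_).trans zero_le
        filter_upwards [Ioc_mem_nhdsGT hδ] with R hR using H R hR.1 hR.2
      · subst ht
        refine (H δ hδ le_rfl).trans (ENNReal.ofReal_le_ofReal ?_)
        simp
        nlinarith
    · refine (H (F/D) (by positivity) (by rw [div_le_iff₀ hDp]; linarith)).trans (ENNReal.ofReal_le_ofReal ?_)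
      have e1 : (F/D)^(1-θ) * D = D ^ θ * F ^ (1-θ) := by
        rw [Real.div_rpow hF hD, Real.rpow_sub hDp, Real.rpow_one]
        field_simp
      have e2 : (F/D)^(-θ) * F = D ^ θ * F ^ (1-θ) := by
        rw [Real.div_rpow hF hD, Real.rpow_neg hF, Real.rpow_neg hD, Real.rpow_sub h, Real.rpow_one]
        field_simp
      have : C * (F/D) ^ (1-θ) * D + C * (F/D) ^ (-θ) * F = 2 * C * (D ^ θ * F ^ (1-θ)) := by
        rw [mul_assoc, e1, mul_assoc, e2]; ring
      linarith

/-- Lemma 2.3, inequality (2.6): local anisotropic Sobolev inequality on `B((ξ+3η)/4)`: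
for `q_j ∈ [2,∞)` with `0 ≤ 1/q̄ − 1/2 ≤ 1` and all `0 < ξ < η`, `f ∈ C^∞(ℝ³)`:
`‖f‖_{L^{q⃗}(B((ξ+3η)/4))} ≤ C ‖∇f‖_{L²(B(η))}^{3/2−1/q̄} ‖f‖_{L²(B(η))}^{1/q̄−1/2}
  + C (η−ξ)^{−(3/2−1/q̄)} ‖f‖_{L²(B(η))}`. -/
theorem aniso_sobolev_local_annular
    (q1 q2 q3 : ℝ) (hq1 : 2 ≤ q1) (hq2 : 2 ≤ q2) (hq3 : 2 ≤ q3)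
    (h0 : 0 ≤ 1/q1 + 1/q2 + 1/q3 - 1/2) (h1 : 1/q1 + 1/q2 + 1/q3 - 1/2 ≤ 1) :
    ∃ C : ℝ, 0 < C ∧
      ∀ (ξ η : ℝ), 0 < ξ → ξ < η → ∀ f : E3 → ℝ, ContDiff ℝ (⊤ : ℕ∞) f →
        anisoNorm q1 q2 q3 (ball (0 : E3) ((ξ + 3*η)/4)) f
          ≤ ENNReal.ofReal C
              * (l2On (ball (0 : E3) η) (fun x => ‖fderiv ℝ f x‖))
                  ^ (3/2 - (1/q1 + 1/q2 + 1/q3))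
              * (l2On (ball (0 : E3) η) f) ^ (1/q1 + 1/q2 + 1/q3 - 1/2)
            + ENNReal.ofReal C
              * ENNReal.ofReal ((η - ξ) ^ (-(3/2 - (1/q1 + 1/q2 + 1/q3))))
              * l2On (ball (0 : E3) η) f := by
  obtain ⟨θ, hθ⟩ : ∃ θ, θ = 3/2 - (1/q1 + 1/q2 + 1/q3) := ⟨_, rfl⟩
  have hθ' : 1/q1 + 1/q2 + 1/q3 - 1/2 = 1 - θ := by linarith
  have t0 : 0 ≤ θ := by linarith
  have t1 : θ ≤ 1 := by linarith
  obtain ⟨C, hC, H⟩ := as_main q1 q2 q3 θ hq1 hq2 hq3 hθ t0 t1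
  refine ⟨4 * C, by positivity, ?_⟩
  intro ξ η hξ hη f hf
  rw [hθ', ← hθ]
  have hf1 : ContDiff ℝ 1 f := hf.of_le (by exact_mod_cast le_top)
  have fD := l2On_fin η (fun x => ‖fderiv ℝ f x‖) (hf1.continuous_fderiv one_ne_zero).norm
  have fF := l2On_fin η f hf1.continuous
  have hδ : 0 < (η - ξ)/4 := by linarith
  have key := fun R hR (hRd : R ≤ (η - ξ)/4) => H ((ξ + 3*η)/4) η R hR (by linarith) f hf1
  generalize l2On (ball (0 : E3) η) (fun x => ‖fderiv ℝ f x‖) = D' at *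
  generalize l2On (ball (0 : E3) η) f = F' at *
  lift D' to NNReal using fD
  lift F' to NNReal using fF
  rw [← ENNReal.ofReal_coe_nnreal (p := D'), ← ENNReal.ofReal_coe_nnreal (p := F')] at *
  have hD := D'.coe_nonneg
  have hF := F'.coe_nonneg
  generalize (D' : ℝ) = D at *
  generalize (F' : ℝ) = F at *
  have fin := as_opt θ C ((η - ξ)/4) D F t0 t1 hC hδ hD hF _ (fun R hR hRd => by
    have k := key R hR hRd
    rwa [← ENNReal.ofReal_mul (by positivity), ← ENNReal.ofReal_mul (by positivity),
      ← ENNReal.ofReal_add (by positivity) (by positivity)] at k)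
  refine fin.trans ?_
  have hηξ : 0 < η - ξ := by linarith
  rw [ENNReal.ofReal_rpow_of_nonneg hD t0, ENNReal.ofReal_rpow_of_nonneg hF (by linarith),
    ← ENNReal.ofReal_mul (by positivity), ← ENNReal.ofReal_mul (by positivity),
    ← ENNReal.ofReal_mul (by positivity), ← ENNReal.ofReal_mul (by positivity),
    ← ENNReal.ofReal_add (by positivity) (by positivity)]
  apply ENNReal.ofReal_le_ofReal
  have h4 : ((η - ξ)/4) ^ (-θ) ≤ 4 * (η - ξ) ^ (-θ) := by
    rw [Real.div_rpow hηξ.le (by norm_num), Real.rpow_neg (by norm_num : (0:ℝ) ≤ 4), div_inv_eq_mul, mul_comm]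
    have : (4:ℝ) ^ θ ≤ 4 ^ (1:ℝ) := Real.rpow_le_rpow_of_exponent_le (by norm_num) t1
    rw [Real.rpow_one] at this
    gcongr
  have P : 0 ≤ C * (D ^ θ * F ^ (1-θ)) := by positivity
  have Q := mul_le_mul_of_nonneg_left h4 (show 0 ≤ C * F by positivity)
  nlinarith
end
end

section
/- Let q⃗ = (q₁,q₂,q₃) with q_j ∈ [2,∞) for each j and 0 ≤ 1/q̄ − 1/2 ≤ 1, where 1/q̄ := 1/q₁+1/q₂+1/q₃. There exists a constant C, depending only on q⃗, such that for every ϱ > 0 and every f ∈ C^∞(ℝ³) with ∫_{B(√2 ϱ)} f dx = 0: ‖f‖_{L^{q⃗}(B(ϱ))} ≤ C · ‖∇f‖_{L²(B(√2 ϱ))}^{3/2 − 1/q̄} · ‖f‖_{L²(B(√2 ϱ))}^{1/q̄ − 1/2}. -/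
open MeasureTheory ENNReal Set Metric Filter

noncomputable section

/-! ### Mixed norms, interpolation, Minkowski -/

def Ln (a : ℝ) (u : ℝ → ℝ≥0∞) : ℝ≥0∞ := (∫⁻ x, u x ^ (1 / a)) ^ a

def Nm (a1 a2 a3 : ℝ) (u : ℝ → ℝ → ℝ → ℝ≥0∞) : ℝ≥0∞ :=
  Ln a3 (fun z => Ln a2 (fun y => Ln a1 (fun x => u x y z)))

def M3 (u : ℝ → ℝ → ℝ → ℝ≥0∞) : Prop := Measurable (fun p : ℝ × ℝ × ℝ => u p.1 p.2.1 p.2.2)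

lemma Ln_mono {a : ℝ} (ha : 0 < a) {u v : ℝ → ℝ≥0∞} (h : ∀ x, u x ≤ v x) : Ln a u ≤ Ln a v := by
  unfold Ln
  gcongr with x
  exact h x

lemma Ln_holder {b c t : ℝ} (hb : 0 < b) (hc : 0 < c) (ht0 : 0 ≤ t) (ht1 : t ≤ 1)
    {u v : ℝ → ℝ≥0∞} (hu : Measurable u) (hv : Measurable v) :
    Ln ((1 - t) * b + t * c) (fun x => u x ^ (1 - t) * v x ^ t) ≤ Ln b u ^ (1 - t) * Ln c v ^ t := by
  have h1t : 0 ≤ 1 - t := by linarith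
  set a := (1 - t) * b + t * c with ha
  have hapos : 0 < a := by
    rcases ht0.eq_or_lt with h | h
    · rw [ha, ← h]; simpa using hb
    · have : 0 ≤ (1 - t) * b := by positivity
      have : 0 < t * c := by positivity
      linarith
  have key := ENNReal.lintegral_mul_norm_pow_le (μ := volume) (f := fun x => u x ^ (1 / b))
    (g := fun x => v x ^ (1 / c)) (hu.pow_const _).aemeasurable (hv.pow_const _).aemeasurable
    (p := (1 - t) * b / a) (q := t * c / a) (by positivity) (by positivity)
    (by rw [← add_div, ← ha]; exact div_self hapos.ne')
  unfold Ln
  calc (∫⁻ x, (u x ^ (1 - t) * v x ^ t) ^ (1 / a)) ^ a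
      = (∫⁻ x, (u x ^ (1 / b)) ^ ((1 - t) * b / a) * (v x ^ (1 / c)) ^ (t * c / a)) ^ a := by
        congr 2 with x
        rw [ENNReal.mul_rpow_of_nonneg _ _ (by positivity), ← ENNReal.rpow_mul, ← ENNReal.rpow_mul,
          ← ENNReal.rpow_mul, ← ENNReal.rpow_mul]
        congr 2 <;> field_simp
    _ ≤ ((∫⁻ x, u x ^ (1 / b)) ^ ((1 - t) * b / a) * (∫⁻ x, v x ^ (1 / c)) ^ (t * c / a)) ^ a := by
        gcongr
    _ = _ := by
        rw [ENNReal.mul_rpow_of_nonneg _ _ hapos.le, ← ENNReal.rpow_mul, ← ENNReal.rpow_mul,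
          ← ENNReal.rpow_mul, ← ENNReal.rpow_mul]
        congr 2 <;> field_simp

lemma Ln_meas {α : Type*} [MeasurableSpace α] {a : ℝ} {u : ℝ → α → ℝ≥0∞}
    (hu : Measurable (fun p : ℝ × α => u p.1 p.2)) : Measurable (fun y => Ln a (fun x => u x y)) := by
  unfold Ln
  apply Measurable.pow_const
  exact Measurable.lintegral_prod_left' (f := fun p : ℝ × α => u p.1 p.2 ^ (1 / a)) (hu.pow_const _)

lemma M3.m1 {u} (hu : M3 u) (y z : ℝ) : Measurable (fun x => u x y z) :=
  hu.comp (f := fun x => (x, y, z)) (by fun_prop)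

lemma M3.L1 {u} (hu : M3 u) (a : ℝ) :
    Measurable (fun p : ℝ × ℝ => Ln a (fun x => u x p.1 p.2)) :=
  Ln_meas (α := ℝ × ℝ) (u := fun x p => u x p.1 p.2) hu

lemma M3.L2 {u} (hu : M3 u) (a b : ℝ) :
    Measurable (fun z : ℝ => Ln b fun y => Ln a (fun x => u x y z)) :=
  Ln_meas (α := ℝ) (u := fun y z => Ln a (fun x => u x y z)) (hu.L1 a)

lemma Nm_interp {b1 b2 b3 c1 c2 c3 t : ℝ} (hb1 : 0 < b1) (hb2 : 0 < b2) (hb3 : 0 < b3)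
    (hc1 : 0 < c1) (hc2 : 0 < c2) (hc3 : 0 < c3) (ht0 : 0 ≤ t) (ht1 : t ≤ 1)
    {u} (hu : M3 u) :
    Nm ((1 - t) * b1 + t * c1) ((1 - t) * b2 + t * c2) ((1 - t) * b3 + t * c3) u
      ≤ Nm b1 b2 b3 u ^ (1 - t) * Nm c1 c2 c3 u ^ t := by
  have h1t : 0 ≤ 1 - t := by linarith
  have pos : ∀ {b c : ℝ}, 0 < b → 0 < c → 0 < (1 - t) * b + t * c := by
    intro b c hb hc
    rcases ht0.eq_or_lt with h | h
    · rw [← h]; simpa using hb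
    · have : 0 ≤ (1 - t) * b := by positivity
      have : 0 < t * c := by positivity
      linarith
  unfold Nm
  refine le_trans (Ln_mono (pos hb3 hc3) (v := fun z =>
    (Ln b2 (fun y => Ln b1 (fun x => u x y z))) ^ (1 - t) *
    (Ln c2 (fun y => Ln c1 (fun x => u x y z))) ^ t) ?_) (Ln_holder hb3 hc3 ht0 ht1 (hu.L2 _ _) (hu.L2 _ _))
  intro z
  refine le_trans (Ln_mono (pos hb2 hc2) (v := fun y =>
    (Ln b1 (fun x => u x y z)) ^ (1 - t) *
    (Ln c1 (fun x => u x y z)) ^ t) ?_) (Ln_holder hb2 hc2 ht0 ht1 ?_ ?_)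
  · intro y
    refine le_trans (le_of_eq ?_) (Ln_holder hb1 hc1 ht0 ht1 (hu.m1 y z) (hu.m1 y z))
    congr 1 with x
    rw [← ENNReal.rpow_add_of_nonneg _ _ h1t ht0]
    simp
  · exact (hu.L1 b1).comp (f := fun y => (y, z)) (by fun_prop)
  · exact (hu.L1 c1).comp (f := fun y => (y, z)) (by fun_prop)

lemma mink_aux {J R : ℝ≥0∞} {p : ℝ} (hp : 1 ≤ p) (hJ : J ≠ ∞) (h : J ≤ J ^ (1 - 1 / p) * R) :
    J ≤ R ^ p := by
  have hp0 : 0 < p := by linarith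
  rcases eq_or_ne J 0 with h0 | h0
  · simp [h0]
  have h2 : J ^ (1 / p) ≤ R := by
    have e : J = J ^ (1 - 1 / p) * J ^ (1 / p) := by
      rw [← ENNReal.rpow_add _ _ h0 hJ]; simp
    have h3 : J ^ (1 - 1 / p) * J ^ (1 / p) ≤ J ^ (1 - 1 / p) * R := e ▸ h
    have hne : J ^ (1 - 1 / p) ≠ 0 := by simp [ENNReal.rpow_eq_zero_iff, h0, hJ]
    have hnt : J ^ (1 - 1 / p) ≠ ∞ := by simp [ENNReal.rpow_eq_top_iff, h0, hJ]
    exact (ENNReal.mul_le_mul_iff_right hne hnt).1 h3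
  calc J = (J ^ (1 / p)) ^ p := by rw [← ENNReal.rpow_mul]; field_simp; simp
    _ ≤ R ^ p := by gcongr

lemma mink_core {p : ℝ} (hp : 1 ≤ p) {G : ℝ → ℝ → ℝ≥0∞}
    (hG : Measurable (fun q : ℝ × ℝ => G q.1 q.2)) :
    ∫⁻ y, (∫⁻ x, G x y) ^ p ≤ (∫⁻ x, (∫⁻ y, G x y ^ p) ^ (1 / p)) ^ p := by
  have hp0 : 0 < p := by linarith
  set R := ∫⁻ x, (∫⁻ y, G x y ^ p) ^ (1 / p) with hR
  set H : ℝ → ℝ≥0∞ := fun y => ∫⁻ x, G x y with hH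
  have hHm : Measurable H := Measurable.lintegral_prod_left' hG
  have step : ∀ φ : ℝ → ℝ≥0∞, Measurable φ → (∀ y, φ y ≤ H y ^ p) → ∫⁻ y, φ y ≠ ∞ →
      ∫⁻ y, φ y ≤ R ^ p := by
    intro φ hφ hle hfin
    apply mink_aux hp hfin
    have hq : 0 ≤ 1 - 1 / p := by
      rw [sub_nonneg, div_le_one hp0]; exact hp
    calc ∫⁻ y, φ y ≤ ∫⁻ y, φ y ^ (1 - 1 / p) * H y := by
          gcongr with y
          calc φ y = φ y ^ (1 - 1 / p) * φ y ^ (1 / p) := by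
                rw [← ENNReal.rpow_add_of_nonneg _ _ hq (by positivity)]; simp
            _ ≤ φ y ^ (1 - 1 / p) * (H y ^ p) ^ (1 / p) := by gcongr; exact hle y
            _ = _ := by rw [← ENNReal.rpow_mul]; field_simp; simp
      _ = ∫⁻ y, ∫⁻ x, φ y ^ (1 - 1 / p) * G x y := by
          congr 1 with y
          rw [lintegral_const_mul]
          exact hG.comp (f := fun x => (x, y)) (by fun_prop)
      _ = ∫⁻ x, ∫⁻ y, φ y ^ (1 - 1 / p) * G x y := by
          apply lintegral_lintegral_swap
          apply Measurable.aemeasurable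
          apply Measurable.mul
          · exact (hφ.comp measurable_fst).pow_const _
          · exact hG.comp measurable_swap
      _ ≤ ∫⁻ x, (∫⁻ y, φ y) ^ (1 - 1 / p) * (∫⁻ y, G x y ^ p) ^ (1 / p) := by
          gcongr with x
          have hGx : Measurable (fun y => G x y) := hG.comp (f := fun y => (x, y)) (by fun_prop)
          refine le_trans (le_of_eq ?_) (ENNReal.lintegral_mul_norm_pow_le hφ.aemeasurable
            (hGx.pow_const p).aemeasurable hq (by positivity) (by ring))
          congr 1 with y
          rw [← ENNReal.rpow_mul (G x y)]; field_simp; simp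
      _ = _ := by
          rw [lintegral_const_mul]
          apply Measurable.pow_const
          exact Measurable.lintegral_prod_right' (f := fun q : ℝ × ℝ => G q.1 q.2 ^ p) (hG.pow_const _)
  let φ : ℕ → ℝ → ℝ≥0∞ := fun n => (Set.Icc (-(n : ℝ)) n).indicator (fun y => min (H y ^ p) n)
  have hφm : ∀ n, Measurable (φ n) := fun n =>
    ((hHm.pow_const p).min measurable_const).indicator measurableSet_Icc
  have hφle : ∀ n y, φ n y ≤ H y ^ p := by
    intro n y
    simp only [φ]
    refine (Set.indicator_le_self _ _ _).trans (min_le_left _ _)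
  have hsup : ∀ y, H y ^ p = ⨆ n, φ n y := by
    intro y
    apply le_antisymm _ (iSup_le fun n => hφle n y)
    apply le_of_forall_lt
    intro c hc
    obtain ⟨n1, hn1⟩ := exists_nat_ge |y|
    obtain ⟨n2, hn2⟩ := ENNReal.exists_nat_gt (hc.ne_top)
    refine lt_of_lt_of_le ?_ (le_iSup _ (max n1 n2))
    have hy : y ∈ Set.Icc (-((max n1 n2 : ℕ) : ℝ)) ((max n1 n2 : ℕ) : ℝ) := by
      have : |y| ≤ ((max n1 n2 : ℕ) : ℝ) := hn1.trans (by exact_mod_cast le_max_left _ _)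
      exact abs_le.1 this
    simp only [φ, Set.indicator_of_mem hy]
    refine lt_min hc (hn2.trans_le ?_)
    exact_mod_cast le_max_right _ _
  have hmono : Monotone φ := by
    intro m n hmn y
    simp only [φ]
    have hmn' : (m : ℝ) ≤ n := by exact_mod_cast hmn
    calc _ ≤ (Set.Icc (-(n : ℝ)) n).indicator (fun y => min (H y ^ p) m) y := by
          apply Set.indicator_le_indicator_of_subset _ (fun _ => zero_le)
          exact Set.Icc_subset_Icc (by linarith) hmn'
      _ ≤ _ := by
          apply Set.indicator_le_indicator
          gcongr
  calc ∫⁻ y, H y ^ p = ∫⁻ y, ⨆ n, φ n y := by simp_rw [← hsup]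
    _ = ⨆ n, ∫⁻ y, φ n y := lintegral_iSup hφm hmono
    _ ≤ _ := by
      apply iSup_le
      intro n
      apply step _ (hφm n) (hφle n)
      refine ne_top_of_le_ne_top (b := ∫⁻ y, (Set.Icc (-(n : ℝ)) n).indicator (fun _ => (n : ℝ≥0∞)) y) ?_ ?_
      · rw [lintegral_indicator measurableSet_Icc]
        simp [ENNReal.mul_eq_top]
      · apply lintegral_mono
        intro y
        apply Set.indicator_le_indicator
        exact min_le_right _ _

lemma Ln_mink {a b : ℝ} (hb : 0 < b) (hab : b ≤ a) {G : ℝ → ℝ → ℝ≥0∞}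
    (hG : Measurable (fun q : ℝ × ℝ => G q.1 q.2)) :
    Ln b (fun y => Ln a (fun x => G x y)) ≤ Ln a (fun x => Ln b (fun y => G x y)) := by
  have ha : 0 < a := by linarith
  have hp : 1 ≤ a / b := by rw [le_div_iff₀ hb]; linarith
  have key := mink_core hp (G := fun x y => G x y ^ (1 / a)) (hG.pow_const _)
  unfold Ln
  have e1 : ∀ s : ℝ≥0∞, (s ^ (1 / a)) ^ (a / b) = s ^ (1 / b) := by
    intro s; rw [← ENNReal.rpow_mul]; congr 1; field_simp
  have e2 : ∀ s : ℝ≥0∞, (s ^ a) ^ (1 / b) = s ^ (a / b) := by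
    intro s; rw [← ENNReal.rpow_mul]; congr 1; field_simp
  have e3 : ∀ s : ℝ≥0∞, (s ^ b) ^ (1 / a) = s ^ (1 / (a / b)) := by
    intro s; rw [← ENNReal.rpow_mul]; congr 1; field_simp
  simp only [e1] at key
  simp only [e2, e3]
  calc _ ≤ ((∫⁻ x, (∫⁻ y, G x y ^ (1 / b)) ^ (1 / (a / b))) ^ (a / b)) ^ b := by gcongr
    _ = _ := by rw [← ENNReal.rpow_mul]; congr 1; field_simp

lemma Nm_swap12 {a1 a2 a3 : ℝ} (h1 : 0 < a1) (h2 : 0 < a2) (h3 : 0 < a3) (h : a2 ≤ a1) {u} (hu : M3 u) :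
    Nm a1 a2 a3 u ≤ Nm a2 a1 a3 (fun x y z => u y x z) := by
  unfold Nm
  apply Ln_mono h3
  intro z
  exact Ln_mink h2 h (G := fun x y => u x y z)
    (hu.comp (f := fun q : ℝ × ℝ => (q.1, q.2, z)) (by fun_prop))

lemma Nm_swap23 {a1 a2 a3 : ℝ} (h1 : 0 < a1) (h2 : 0 < a2) (h3 : 0 < a3) (h : a3 ≤ a2) {u} (hu : M3 u) :
    Nm a1 a2 a3 u ≤ Nm a1 a3 a2 (fun x y z => u x z y) := by
  unfold Nm
  exact Ln_mink h3 h (G := fun y z => Ln a1 fun x => u x y z) (hu.L1 a1)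

/-! ### The base estimates -/

def tri (w : ℝ → ℝ → ℝ → ℝ≥0∞) : ℝ≥0∞ := ∫⁻ z, ∫⁻ y, ∫⁻ x, w x y z

lemma M3.i1 {w} (hw : M3 w) : Measurable (fun p : ℝ × ℝ => ∫⁻ x, w x p.1 p.2) :=
  Measurable.lintegral_prod_left' (f := fun p : ℝ × (ℝ × ℝ) => w p.1 p.2.1 p.2.2) hw

lemma M3.i1y {w} (hw : M3 w) (z : ℝ) : Measurable (fun y => ∫⁻ x, w x y z) :=
  hw.i1.comp (f := fun y => (y, z)) (by fun_prop)

lemma M3.i2 {w} (hw : M3 w) : Measurable (fun z => ∫⁻ y, ∫⁻ x, w x y z) :=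
  Measurable.lintegral_prod_left' (f := fun p : ℝ × ℝ => ∫⁻ x, w x p.1 p.2) hw.i1

lemma M3.s12 {w} (hw : M3 w) : M3 (fun x y z => w y x z) :=
  hw.comp (g := fun p : ℝ × ℝ × ℝ => w p.1 p.2.1 p.2.2)
    (f := fun p : ℝ × ℝ × ℝ => (p.2.1, p.1, p.2.2)) (by fun_prop)

lemma M3.s23 {w} (hw : M3 w) : M3 (fun x y z => w x z y) :=
  hw.comp (g := fun p : ℝ × ℝ × ℝ => w p.1 p.2.1 p.2.2)
    (f := fun p : ℝ × ℝ × ℝ => (p.1, p.2.2, p.2.1)) (by fun_prop)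

lemma M3.pow {w} (hw : M3 w) (n : ℕ) : M3 (fun x y z => w x y z ^ n) := Measurable.pow_const hw n

lemma M3.mul {w w'} (hw : M3 w) (hw' : M3 w') : M3 (fun x y z => w x y z * w' x y z) :=
  Measurable.mul hw hw'

lemma M3.swapxy {w} (hw : M3 w) (z : ℝ) :
    ∫⁻ y, ∫⁻ x, w x y z = ∫⁻ x, ∫⁻ y, w x y z := by
  apply lintegral_lintegral_swap
  apply Measurable.aemeasurable
  exact Measurable.comp (g := fun p : ℝ × ℝ × ℝ => w p.1 p.2.1 p.2.2)
    (f := fun p : ℝ × ℝ => (p.2, p.1, z)) hw (by fun_prop)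

lemma tri_s12 {w} (hw : M3 w) : tri (fun x y z => w y x z) = tri w := by
  unfold tri
  congr 1 with z
  exact (hw.swapxy z).symm

lemma tri_s23 {w} (hw : M3 w) : tri (fun x y z => w x z y) = tri w := by
  unfold tri
  apply lintegral_lintegral_swap
  apply Measurable.aemeasurable
  exact hw.i1

lemma hol2 {F G : ℝ → ℝ → ℝ → ℝ≥0∞} (hF : M3 F) (hG : M3 G) {p q : ℝ} (hp : 0 ≤ p) (hq : 0 ≤ q)
    (hpq : p + q = 1) (z : ℝ) :
    ∫⁻ y, ∫⁻ x, F x y z ^ p * G x y z ^ q ≤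
      (∫⁻ y, ∫⁻ x, F x y z) ^ p * (∫⁻ y, ∫⁻ x, G x y z) ^ q := by
  refine le_trans ?_ (ENNReal.lintegral_mul_norm_pow_le (hF.i1y z).aemeasurable
    (hG.i1y z).aemeasurable hp hq hpq)
  gcongr with y
  exact ENNReal.lintegral_mul_norm_pow_le (hF.m1 y z).aemeasurable (hG.m1 y z).aemeasurable hp hq hpq

lemma hol3 {F G : ℝ → ℝ → ℝ → ℝ≥0∞} (hF : M3 F) (hG : M3 G) {p q : ℝ} (hp : 0 ≤ p) (hq : 0 ≤ q)
    (hpq : p + q = 1) :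
    tri (fun x y z => F x y z ^ p * G x y z ^ q) ≤ tri F ^ p * tri G ^ q := by
  unfold tri
  refine le_trans ?_ (ENNReal.lintegral_mul_norm_pow_le hF.i2.aemeasurable
    hG.i2.aemeasurable hp hq hpq)
  gcongr with z
  exact hol2 hF hG hp hq hpq z

lemma sq_half (x : ℝ≥0∞) : (x ^ 2) ^ (1 / 2 : ℝ) = x := by
  rw [← ENNReal.rpow_natCast, ← ENNReal.rpow_mul]; simp

lemma half_sq (x : ℝ≥0∞) : (x ^ (1 / 2 : ℝ)) ^ 2 = x := by
  rw [← ENNReal.rpow_natCast, ← ENNReal.rpow_mul]; simp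

lemma pow_two_half (x : ℝ≥0∞) (n : ℕ) : (x ^ (2 * n)) ^ (1 / 2 : ℝ) = x ^ n := by
  rw [mul_comm, pow_mul, sq_half]

structure PD (K : ℝ≥0∞) (u v : ℝ → ℝ → ℝ → ℝ≥0∞) : Prop where
  mu : M3 u
  mv : M3 v
  h1 : ∀ (m : ℕ) (x y z : ℝ), u x y z ^ (m + 1) ≤ (m + 1 : ℕ) * ∫⁻ t, u t y z ^ m * v t y z
  h2 : ∀ (m : ℕ) (x y z : ℝ), u x y z ^ (m + 1) ≤ (m + 1 : ℕ) * ∫⁻ t, u x t z ^ m * v x t z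
  h3 : ∀ (m : ℕ) (x y z : ℝ), u x y z ^ (m + 1) ≤ (m + 1 : ℕ) * ∫⁻ t, u x y t ^ m * v x y t
  six : tri (fun x y z => u x y z ^ 6) ≤ K * tri (fun x y z => v x y z ^ 2) ^ 3

lemma PD.s12 {K u v} (h : PD K u v) : PD K (fun x y z => u y x z) (fun x y z => v y x z) where
  mu := h.mu.s12
  mv := h.mv.s12
  h1 := fun m x y z => h.h2 m y x z
  h2 := fun m x y z => h.h1 m y x z
  h3 := fun m x y z => h.h3 m y x z
  six := by
    rw [tri_s12 (h.mu.pow 6), tri_s12 (h.mv.pow 2)]; exact h.six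

lemma PD.s23 {K u v} (h : PD K u v) : PD K (fun x y z => u x z y) (fun x y z => v x z y) where
  mu := h.mu.s23
  mv := h.mv.s23
  h1 := fun m x y z => h.h1 m x z y
  h2 := fun m x y z => h.h3 m x z y
  h3 := fun m x y z => h.h2 m x z y
  six := by
    rw [tri_s23 (h.mu.pow 6), tri_s23 (h.mv.pow 2)]; exact h.six

/-- two-dimensional recursion -/
lemma PD.rec2 {K u v} (h : PD K u v) (m : ℕ) (z : ℝ) :
    ∫⁻ y, ∫⁻ x, u x y z ^ (2 * (m + 1)) ≤
      ((m + 1 : ℕ) : ℝ≥0∞) ^ 2 * (∫⁻ y, ∫⁻ x, v x y z ^ 2) * ∫⁻ y, ∫⁻ x, u x y z ^ (2 * m) := by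
  have hw : M3 (fun x y z => u x y z ^ m * v x y z) := (h.mu.pow m).mul h.mv
  have hcs : ∫⁻ y, ∫⁻ x, u x y z ^ m * v x y z ≤
      (∫⁻ y, ∫⁻ x, u x y z ^ (2 * m)) ^ (1 / 2 : ℝ) * (∫⁻ y, ∫⁻ x, v x y z ^ 2) ^ (1 / 2 : ℝ) := by
    refine le_trans (le_of_eq ?_) (hol2 (h.mu.pow (2 * m)) (h.mv.pow 2)
      (by norm_num) (by norm_num) (by norm_num) z)
    simp only [pow_two_half, sq_half]
  set c : ℝ≥0∞ := ((m + 1 : ℕ) : ℝ≥0∞) with hc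
  calc ∫⁻ y, ∫⁻ x, u x y z ^ (2 * (m + 1))
      ≤ ∫⁻ y, ∫⁻ x, (c * ∫⁻ t, u t y z ^ m * v t y z) * (c * ∫⁻ t, u x t z ^ m * v x t z) := by
        gcongr with y x
        rw [two_mul, pow_add]
        exact mul_le_mul' (h.h1 m x y z) (h.h2 m x y z)
    _ = (c * ∫⁻ y, ∫⁻ x, u x y z ^ m * v x y z) * (c * ∫⁻ x, ∫⁻ y, u x y z ^ m * v x y z) := by
        have m1 : Measurable fun x => ∫⁻ t, u x t z ^ m * v x t z := hw.s12.i1y z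
        have m2 : Measurable fun y => ∫⁻ t, u t y z ^ m * v t y z := hw.i1y z
        have e : ∀ y, ∫⁻ x, (c * ∫⁻ t, u t y z ^ m * v t y z) * (c * ∫⁻ t, u x t z ^ m * v x t z)
            = (c * ∫⁻ t, u t y z ^ m * v t y z) * (c * ∫⁻ x, ∫⁻ t, u x t z ^ m * v x t z) := by
          intro y
          rw [lintegral_const_mul _ (m1.const_mul c), lintegral_const_mul _ m1]
        simp_rw [e]
        rw [lintegral_mul_const _ (m2.const_mul c), lintegral_const_mul _ m2]
    _ = c ^ 2 * (∫⁻ y, ∫⁻ x, u x y z ^ m * v x y z) ^ 2 := by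
        rw [← hw.swapxy z]; ring
    _ ≤ c ^ 2 * ((∫⁻ y, ∫⁻ x, u x y z ^ (2 * m)) ^ (1 / 2 : ℝ) *
          (∫⁻ y, ∫⁻ x, v x y z ^ 2) ^ (1 / 2 : ℝ)) ^ 2 := by gcongr
    _ = _ := by
        rw [mul_pow, half_sq, half_sq]; ring

lemma PD.rec2k (k m : ℕ) : ∃ c : ℝ≥0∞, c ≠ ∞ ∧ ∀ K u v, PD K u v → ∀ z,
    ∫⁻ y, ∫⁻ x, u x y z ^ (2 * (m + k)) ≤
      c * (∫⁻ y, ∫⁻ x, v x y z ^ 2) ^ m * ∫⁻ y, ∫⁻ x, u x y z ^ (2 * k) := by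
  induction m with
  | zero => exact ⟨1, by simp, fun K u v h z => by simp⟩
  | succ m ih =>
    obtain ⟨c, hc, ih⟩ := ih
    refine ⟨((m + k + 1 : ℕ) : ℝ≥0∞) ^ 2 * c, ENNReal.mul_ne_top (by simp) hc, fun K u v h z => ?_⟩
    have := h.rec2 (m + k) z
    rw [show m + 1 + k = m + k + 1 by ring]
    refine this.trans ?_
    calc _ ≤ ((m + k + 1 : ℕ) : ℝ≥0∞) ^ 2 * (∫⁻ y, ∫⁻ x, v x y z ^ 2) *
          (c * (∫⁻ y, ∫⁻ x, v x y z ^ 2) ^ m * ∫⁻ y, ∫⁻ x, u x y z ^ (2 * k)) := by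
          gcongr; exact ih K u v h z
      _ = _ := by ring

lemma tri_uv {K u v} (h : PD K u v) (k : ℕ) :
    tri (fun x y z => u x y z ^ k * v x y z) ≤
      tri (fun x y z => u x y z ^ (2 * k)) ^ (1 / 2 : ℝ) * tri (fun x y z => v x y z ^ 2) ^ (1 / 2 : ℝ) := by
  refine le_trans (le_of_eq ?_) (hol3 (h.mu.pow (2 * k)) (h.mv.pow 2)
      (by norm_num) (by norm_num) (by norm_num))
  simp only [pow_two_half, sq_half]

lemma PD.sup4 {K u v} (h : PD K u v) (z : ℝ) :
    ∫⁻ y, ∫⁻ x, u x y z ^ (2 * 2) ≤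
      4 * K ^ (1 / 2 : ℝ) * tri (fun x y z => v x y z ^ 2) ^ 2 := by
  have hw : M3 (fun x y z => u x y z ^ 3 * v x y z) := (h.mu.pow 3).mul h.mv
  set T := tri (fun x y z => v x y z ^ 2)
  calc ∫⁻ y, ∫⁻ x, u x y z ^ (2 * 2) ≤ ∫⁻ y, ∫⁻ x, 4 * ∫⁻ t, u x y t ^ 3 * v x y t := by
        gcongr with y x
        have := h.h3 3 x y z
        norm_num at this ⊢
        exact this
    _ = 4 * tri (fun x y z => u x y z ^ 3 * v x y z) := by
        rw [← tri_s23 hw, ← tri_s12 hw.s23]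
        unfold tri
        have m2 : M3 (fun x y z => u y z x ^ 3 * v y z x) := hw.s23.s12
        have e : ∀ y, ∫⁻ x, 4 * ∫⁻ t, u x y t ^ 3 * v x y t
            = 4 * ∫⁻ x, ∫⁻ t, u x y t ^ 3 * v x y t := by
          intro y
          rw [lintegral_const_mul]
          exact m2.i1.comp (f := fun x => (x, y)) (by fun_prop)
        simp_rw [e]
        rw [lintegral_const_mul _ m2.i2]
    _ ≤ 4 * ((K * T ^ 3) ^ (1 / 2 : ℝ) * T ^ (1 / 2 : ℝ)) := by
        gcongr
        refine (tri_uv h 3).trans ?_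
        gcongr
        exact h.six
    _ = _ := by
        rw [← ENNReal.mul_rpow_of_nonneg _ _ (by norm_num),
          show K * T ^ 3 * T = K * (T ^ 2) ^ 2 by ring, ENNReal.mul_rpow_of_nonneg _ _ (by norm_num),
          sq_half, mul_assoc]

def Good (a1 a2 a3 : ℝ) : Prop := ∀ K : ℝ≥0∞, K ≠ ∞ → ∃ C : ℝ≥0∞, C ≠ ∞ ∧ ∀ u v, PD K u v →
  Nm a1 a2 a3 u ≤ C * tri (fun x y z => v x y z ^ 2) ^ ((3 / 2 - (a1 + a2 + a3)) / 2) *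
    tri (fun x y z => u x y z ^ 2) ^ ((a1 + a2 + a3 - 1 / 2) / 2)

lemma Ln_Ln {a : ℝ} (ha : 0 < a) (w : ℝ → ℝ → ℝ≥0∞) :
    Ln a (fun y => Ln a (fun x => w x y)) = (∫⁻ y, ∫⁻ x, w x y ^ (1 / a)) ^ a := by
  unfold Ln
  congr 2 with y
  rw [← ENNReal.rpow_mul]
  field_simp
  simp

lemma rp2 (x : ℝ≥0∞) (n : ℕ) : x ^ (1 / (1 / (2 * (n : ℝ)))) = x ^ (2 * n) := by
  rw [one_div_one_div, ← ENNReal.rpow_natCast]; push_cast; rfl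

lemma good_O : Good (1 / 2) (1 / 2) (1 / 2) := by
  intro K _
  refine ⟨1, by simp, fun u v h => le_of_eq ?_⟩
  have : ∀ x : ℝ≥0∞, x ^ (1 / (1 / 2 : ℝ)) = x ^ 2 := by
    intro x; rw [← ENNReal.rpow_natCast]; norm_num
  unfold Nm
  simp_rw [Ln_Ln (show (0 : ℝ) < 1 / 2 by norm_num)]
  unfold Ln
  simp_rw [this, half_sq]
  unfold tri
  norm_num

/-- corner with an `L²` outer norm -/
lemma good_E (m : ℕ) : Good (1 / (2 * ((m + 1 : ℕ) : ℝ))) (1 / (2 * ((m + 1 : ℕ) : ℝ))) (1 / 2) := by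
  intro K _
  obtain ⟨c, hc, hrec⟩ := PD.rec2k 1 m
  set n : ℕ := m + 1 with hn
  have hn0 : (0 : ℝ) < n := by positivity
  have hnm : (n : ℝ) = m + 1 := by rw [hn]; push_cast; ring
  refine ⟨c ^ (1 / (2 * (n : ℝ))), by simp [ENNReal.rpow_eq_top_iff, hc, hn0], fun u v h => ?_⟩
  unfold Nm
  simp_rw [Ln_Ln (show (0 : ℝ) < 1 / (2 * n) by positivity), rp2]
  unfold Ln
  have hW := (h.mv.pow 2).i2
  have hU := (h.mu.pow 2).i2
  set W : ℝ → ℝ≥0∞ := fun z => ∫⁻ y, ∫⁻ x, v x y z ^ 2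
  set U : ℝ → ℝ≥0∞ := fun z => ∫⁻ y, ∫⁻ x, u x y z ^ 2
  have hT : tri (fun x y z => v x y z ^ 2) = ∫⁻ z, W z := rfl
  have hL : tri (fun x y z => u x y z ^ 2) = ∫⁻ z, U z := rfl
  rw [hT, hL]
  calc (∫⁻ z, ((∫⁻ y, ∫⁻ x, u x y z ^ (2 * n)) ^ (1 / (2 * (n : ℝ)))) ^ (1 / (1 / 2 : ℝ))) ^ (1 / 2 : ℝ)
      ≤ (∫⁻ z, c ^ (1 / (n : ℝ)) * (W z ^ (m / n : ℝ) * U z ^ (1 / n : ℝ))) ^ (1 / 2 : ℝ) := by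
        gcongr with z
        rw [← ENNReal.rpow_mul, show 1 / (2 * (n : ℝ)) * (1 / (1 / 2)) = 1 / n by field_simp]
        calc _ ≤ (c * W z ^ m * U z) ^ (1 / (n : ℝ)) := by
              gcongr
              exact hrec K u v h z
          _ = _ := by
              rw [ENNReal.mul_rpow_of_nonneg _ _ (by positivity),
                ENNReal.mul_rpow_of_nonneg _ _ (by positivity), ← ENNReal.rpow_natCast,
                ← ENNReal.rpow_mul, mul_assoc]
              congr 3
              ring
    _ = (c ^ (1 / (n : ℝ)) * ∫⁻ z, (W z ^ (m / n : ℝ) * U z ^ (1 / n : ℝ))) ^ (1 / 2 : ℝ) := by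
        rw [lintegral_const_mul]
        exact (hW.pow_const _).mul (hU.pow_const _)
    _ ≤ (c ^ (1 / (n : ℝ)) * ((∫⁻ z, W z) ^ (m / n : ℝ) * (∫⁻ z, U z) ^ (1 / n : ℝ))) ^ (1 / 2 : ℝ) := by
        gcongr
        exact ENNReal.lintegral_mul_norm_pow_le hW.aemeasurable hU.aemeasurable (by positivity)
          (by positivity) (by rw [hnm]; field_simp)
    _ = _ := by
        rw [ENNReal.mul_rpow_of_nonneg _ _ (by norm_num), ENNReal.mul_rpow_of_nonneg _ _ (by norm_num),
          ← ENNReal.rpow_mul, ← ENNReal.rpow_mul, ← ENNReal.rpow_mul, ← mul_assoc]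
        rw [show 1 / (n : ℝ) * (1 / 2) = 1 / (2 * n) by field_simp,
          show (m / n : ℝ) * (1 / 2) = (3 / 2 - (1 / (2 * n) + 1 / (2 * n) + 1 / 2)) / 2 by
            rw [hnm]; field_simp; ring,
          show (1 / (2 * n) + 1 / (2 * n) + 1 / 2 - 1 / 2) / 2 = 1 / (2 * (n : ℝ)) by field_simp; ring]

/-- corner on the critical plane -/
lemma good_C (m : ℕ) (hm : 1 ≤ m) : Good (1 / (2 * ((m + 2 : ℕ) : ℝ))) (1 / (2 * ((m + 2 : ℕ) : ℝ)))
    (1 / 2 - 2 * (1 / (2 * ((m + 2 : ℕ) : ℝ)))) := by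
  intro K hK
  obtain ⟨c, hc, hrec⟩ := PD.rec2k 2 m
  set n : ℕ := m + 2 with hn
  have hn0 : (0 : ℝ) < n := by positivity
  have hm0 : (0 : ℝ) < m := by positivity
  have hnm : (n : ℝ) = m + 2 := by rw [hn]; push_cast; ring
  have ha : 1 / 2 - 2 * (1 / (2 * (n : ℝ))) = m / (2 * n) := by
    rw [hnm]; field_simp; ring
  rw [ha]
  set S : ℝ≥0∞ := 4 * K ^ (1 / 2 : ℝ) with hS
  have hSt : S ≠ ∞ := ENNReal.mul_ne_top (by simp) (by simp [ENNReal.rpow_eq_top_iff, hK])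
  refine ⟨(c * S) ^ (1 / (2 * (n : ℝ))), ?_, fun u v h => ?_⟩
  · have : c * S ≠ ∞ := ENNReal.mul_ne_top hc hSt
    exact ENNReal.rpow_ne_top_of_nonneg (by positivity) this
  unfold Nm
  simp_rw [Ln_Ln (show (0 : ℝ) < 1 / (2 * n) by positivity), rp2]
  unfold Ln
  have hW := (h.mv.pow 2).i2
  set W : ℝ → ℝ≥0∞ := fun z => ∫⁻ y, ∫⁻ x, v x y z ^ 2
  have hT : tri (fun x y z => v x y z ^ 2) = ∫⁻ z, W z := rfl
  have h4 := h.sup4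
  rw [← hS] at h4
  rw [hT] at h4 ⊢
  set T := ∫⁻ z, W z
  have hz : (1 / (2 * (n : ℝ)) + 1 / (2 * (n : ℝ)) + m / (2 * (n : ℝ)) - 1 / 2) / 2 = 0 := by
    rw [hnm]; field_simp; ring
  have hz' : (3 / 2 - (1 / (2 * (n : ℝ)) + 1 / (2 * (n : ℝ)) + m / (2 * (n : ℝ)))) / 2 = 1 / 2 := by
    rw [hnm]; field_simp; ring
  rw [hz, hz', ENNReal.rpow_zero, mul_one]
  calc (∫⁻ z, ((∫⁻ y, ∫⁻ x, u x y z ^ (2 * n)) ^ (1 / (2 * (n : ℝ)))) ^ (1 / (m / (2 * n : ℝ)))) ^ (m / (2 * n : ℝ))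
      ≤ (∫⁻ z, (c * S * T ^ 2) ^ (1 / (m : ℝ)) * W z) ^ (m / (2 * n : ℝ)) := by
        gcongr with z
        rw [← ENNReal.rpow_mul, show 1 / (2 * (n : ℝ)) * (1 / (m / (2 * n))) = 1 / m by field_simp]
        calc _ ≤ (c * W z ^ m * (S * T ^ 2)) ^ (1 / (m : ℝ)) := by
              gcongr
              refine (hrec K u v h z).trans ?_
              gcongr
              exact h4 z
          _ = ((c * S * T ^ 2) * W z ^ m) ^ (1 / (m : ℝ)) := by congr 1; ring
          _ = _ := by
              rw [ENNReal.mul_rpow_of_nonneg _ _ (by positivity), ← ENNReal.rpow_natCast (W z),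
                ← ENNReal.rpow_mul]
              congr 1
              field_simp
              simp
    _ = ((c * S * T ^ 2) ^ (1 / (m : ℝ)) * T) ^ (m / (2 * n : ℝ)) := by
        rw [lintegral_const_mul _ hW]
    _ = _ := by
        rw [ENNReal.mul_rpow_of_nonneg _ _ (by positivity), ← ENNReal.rpow_mul,
          ENNReal.mul_rpow_of_nonneg _ _ (by positivity), ← ENNReal.rpow_natCast, ← ENNReal.rpow_mul,
          mul_assoc, ← ENNReal.rpow_add_of_nonneg _ _ (by positivity) (by positivity)]
        congr 2
        · field_simp
        · rw [hnm]; push_cast; field_simp; ring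

/-- edge point -/
lemma good_F (m : ℕ) : Good (1 / (2 * ((m + 1 : ℕ) : ℝ))) (1 / 2) (1 / 2) := by
  intro K _
  set n : ℕ := m + 1 with hn
  have hn0 : (0 : ℝ) < n := by positivity
  have hnm : (n : ℝ) = m + 1 := by rw [hn]; push_cast; ring
  refine ⟨2 ^ (m / (2 * n) : ℝ), ENNReal.rpow_ne_top_of_nonneg (by positivity) (by simp), fun u v h => ?_⟩
  have e2 : ∀ x : ℝ≥0∞, x ^ (1 / (1 / 2 : ℝ)) = x ^ 2 := by
    intro x; rw [← ENNReal.rpow_natCast]; norm_num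
  unfold Nm
  rw [Ln_Ln (show (0 : ℝ) < 1 / 2 by norm_num) (fun y z => Ln (1 / (2 * (n : ℝ))) fun x => u x y z)]
  unfold Ln
  simp_rw [rp2]
  set T := tri (fun x y z => v x y z ^ 2)
  set L := tri (fun x y z => u x y z ^ 2) with hL
  have hw : M3 (fun x y z => u x y z * v x y z) := h.mu.mul h.mv
  have hB := hw.i1
  have hJ := (h.mu.pow 2).i1
  have hBL : M3 (fun x y _ => 2 * ∫⁻ t, u t x y * v t x y) :=
    Measurable.comp (g := fun p : ℝ × ℝ => 2 * ∫⁻ t, u t p.1 p.2 * v t p.1 p.2)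
      (f := fun p : ℝ × ℝ × ℝ => (p.1, p.2.1)) (hB.const_mul 2) (by fun_prop)
  have hJL : M3 (fun x y _ => ∫⁻ t, u t x y ^ 2) :=
    Measurable.comp (g := fun p : ℝ × ℝ => ∫⁻ t, u t p.1 p.2 ^ 2)
      (f := fun p : ℝ × ℝ × ℝ => (p.1, p.2.1)) hJ (by fun_prop)
  have hIB : ∫⁻ z, ∫⁻ y, 2 * ∫⁻ t, u t y z * v t y z ≤ 2 * (L ^ (1 / 2 : ℝ) * T ^ (1 / 2 : ℝ)) := by
    have e : ∀ z, ∫⁻ y, 2 * ∫⁻ t, u t y z * v t y z = 2 * ∫⁻ y, ∫⁻ t, u t y z * v t y z :=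
      fun z => lintegral_const_mul _ (hw.i1y z)
    simp_rw [e]
    rw [lintegral_const_mul _ hw.i2]
    gcongr
    have := tri_uv h 1
    simp only [pow_one, mul_one] at this
    exact this
  calc (∫⁻ z, ∫⁻ y, ((∫⁻ x, u x y z ^ (2 * n)) ^ (1 / (2 * (n : ℝ)))) ^ (1 / (1 / 2 : ℝ))) ^ (1 / 2 : ℝ)
      ≤ (∫⁻ z, ∫⁻ y, (2 * ∫⁻ t, u t y z * v t y z) ^ (m / n : ℝ) * (∫⁻ t, u t y z ^ 2) ^ (1 / n : ℝ)) ^ (1 / 2 : ℝ) := by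
        gcongr with z y
        rw [← ENNReal.rpow_mul, show 1 / (2 * (n : ℝ)) * (1 / (1 / 2)) = 1 / n by field_simp]
        calc _ ≤ ((2 * ∫⁻ t, u t y z * v t y z) ^ m * ∫⁻ t, u t y z ^ 2) ^ (1 / (n : ℝ)) := by
              gcongr
              rw [← lintegral_const_mul _ ((h.mu.pow 2).m1 y z)]
              gcongr with x
              rw [hn, pow_mul, pow_succ]
              gcongr
              have := h.h1 1 x y z
              norm_num at this
              exact this
          _ = _ := by
              rw [ENNReal.mul_rpow_of_nonneg _ _ (by positivity), ← ENNReal.rpow_natCast,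
                ← ENNReal.rpow_mul]
              congr 2
              ring
    _ ≤ ((∫⁻ z, ∫⁻ y, 2 * ∫⁻ t, u t y z * v t y z) ^ (m / n : ℝ) *
          (∫⁻ z, ∫⁻ y, ∫⁻ t, u t y z ^ 2) ^ (1 / n : ℝ)) ^ (1 / 2 : ℝ) := by
        gcongr
        exact hol2 hBL hJL (by positivity) (by positivity) (by rw [hnm]; field_simp) 0
    _ ≤ ((2 * (L ^ (1 / 2 : ℝ) * T ^ (1 / 2 : ℝ))) ^ (m / n : ℝ) * L ^ (1 / n : ℝ)) ^ (1 / 2 : ℝ) := by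
        gcongr
        exact le_of_eq rfl
    _ = 2 ^ (m / (2 * n) : ℝ) * T ^ (m / (4 * n) : ℝ) * (L ^ (m / (4 * n) : ℝ) * L ^ (1 / (2 * n) : ℝ)) := by
        rw [ENNReal.mul_rpow_of_nonneg _ _ (by positivity), ENNReal.mul_rpow_of_nonneg _ _ (by positivity),
          ENNReal.mul_rpow_of_nonneg _ _ (by positivity),
          ENNReal.mul_rpow_of_nonneg _ _ (by positivity), ENNReal.mul_rpow_of_nonneg _ _ (by positivity)]
        simp only [← ENNReal.rpow_mul]
        rw [show (m / n : ℝ) * (1 / 2) = m / (2 * n) by field_simp,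
          show (1 / 2 : ℝ) * (m / n : ℝ) * (1 / 2) = m / (4 * n) by field_simp; ring,
          show (1 / n : ℝ) * (1 / 2) = 1 / (2 * n) by field_simp]
        ring
    _ = _ := by
        rw [← ENNReal.rpow_add_of_nonneg _ _ (by positivity) (by positivity)]
        congr 2
        · congr 1
          rw [hnm]; field_simp; ring
        · rw [hnm]; field_simp; ring

lemma Good.s12 {a1 a2 a3 : ℝ} (h : Good a2 a1 a3) (h1 : 0 < a1) (h2 : 0 < a2) (h3 : 0 < a3)
    (h12 : a2 ≤ a1) : Good a1 a2 a3 := by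
  intro K hK
  obtain ⟨C, hC, H⟩ := h K hK
  refine ⟨C, hC, fun u v hd => (Nm_swap12 h1 h2 h3 h12 hd.mu).trans ?_⟩
  have := H _ _ hd.s12
  rwa [tri_s12 (hd.mu.pow 2), tri_s12 (hd.mv.pow 2), add_comm a2 a1] at this

lemma Good.s23 {a1 a2 a3 : ℝ} (h : Good a1 a3 a2) (h1 : 0 < a1) (h2 : 0 < a2) (h3 : 0 < a3)
    (h12 : a3 ≤ a2) : Good a1 a2 a3 := by
  intro K hK
  obtain ⟨C, hC, H⟩ := h K hK
  refine ⟨C, hC, fun u v hd => (Nm_swap23 h1 h2 h3 h12 hd.mu).trans ?_⟩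
  have := H _ _ hd.s23
  rwa [tri_s23 (hd.mu.pow 2), tri_s23 (hd.mv.pow 2), add_right_comm a1 a3 a2] at this

lemma Good.interp {b1 b2 b3 c1 c2 c3 : ℝ} (hb : Good b1 b2 b3) (hc : Good c1 c2 c3)
    (hb1 : 0 < b1) (hb2 : 0 < b2) (hb3 : 0 < b3) (hc1 : 0 < c1) (hc2 : 0 < c2) (hc3 : 0 < c3)
    (hbl : 1 / 2 ≤ b1 + b2 + b3) (hbu : b1 + b2 + b3 ≤ 3 / 2)
    (hcl : 1 / 2 ≤ c1 + c2 + c3) (hcu : c1 + c2 + c3 ≤ 3 / 2)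
    (t : ℝ) (ht0 : 0 ≤ t) (ht1 : t ≤ 1) {a1 a2 a3 : ℝ} (e1 : a1 = (1 - t) * b1 + t * c1)
    (e2 : a2 = (1 - t) * b2 + t * c2) (e3 : a3 = (1 - t) * b3 + t * c3) : Good a1 a2 a3 := by
  subst e1 e2 e3
  intro K hK
  obtain ⟨B, hB, HB⟩ := hb K hK
  obtain ⟨C, hC, HC⟩ := hc K hK
  have h1t : 0 ≤ 1 - t := by linarith
  refine ⟨B ^ (1 - t) * C ^ t, ENNReal.mul_ne_top (ENNReal.rpow_ne_top_of_nonneg h1t hB)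
    (ENNReal.rpow_ne_top_of_nonneg ht0 hC), fun u v hd => ?_⟩
  refine (Nm_interp hb1 hb2 hb3 hc1 hc2 hc3 ht0 ht1 hd.mu).trans ?_
  set T := tri (fun x y z => v x y z ^ 2)
  set L := tri (fun x y z => u x y z ^ 2)
  have p1 : 0 ≤ (3 / 2 - (b1 + b2 + b3)) / 2 := by linarith
  have p2 : 0 ≤ (3 / 2 - (c1 + c2 + c3)) / 2 := by linarith
  have p3 : 0 ≤ (b1 + b2 + b3 - 1 / 2) / 2 := by linarith
  have p4 : 0 ≤ (c1 + c2 + c3 - 1 / 2) / 2 := by linarith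
  calc _ ≤ (B * T ^ ((3 / 2 - (b1 + b2 + b3)) / 2) * L ^ ((b1 + b2 + b3 - 1 / 2) / 2)) ^ (1 - t) *
        (C * T ^ ((3 / 2 - (c1 + c2 + c3)) / 2) * L ^ ((c1 + c2 + c3 - 1 / 2) / 2)) ^ t := by
        gcongr
        · exact HB u v hd
        · exact HC u v hd
    _ = B ^ (1 - t) * C ^ t *
        (T ^ ((3 / 2 - (b1 + b2 + b3)) / 2 * (1 - t)) * T ^ ((3 / 2 - (c1 + c2 + c3)) / 2 * t)) *
        (L ^ ((b1 + b2 + b3 - 1 / 2) / 2 * (1 - t)) * L ^ ((c1 + c2 + c3 - 1 / 2) / 2 * t)) := by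
        simp only [ENNReal.mul_rpow_of_nonneg _ _ h1t, ENNReal.mul_rpow_of_nonneg _ _ ht0,
          ← ENNReal.rpow_mul]
        ring
    _ = _ := by
        rw [← ENNReal.rpow_add_of_nonneg _ _ (by positivity) (by positivity),
          ← ENNReal.rpow_add_of_nonneg _ _ (by positivity) (by positivity)]
        congr 2
        · congr 1
          ring
        · ring

/-! ### All admissible exponents are good -/

lemma exists_eps {d : ℝ} (hd : 0 < d) : ∃ m : ℕ, 2 ≤ m ∧ 1 / (2 * ((m + 1 : ℕ) : ℝ)) < d ∧
    1 / (2 * ((m + 2 : ℕ) : ℝ)) < d := by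
  obtain ⟨n, hn⟩ := exists_nat_gt (1 / d)
  have hn0 : (0 : ℝ) < n := lt_trans (by positivity) hn
  have h1 : 1 < n * d := by rwa [div_lt_iff₀ hd] at hn
  refine ⟨n + 2, by omega, ?_, ?_⟩
  · rw [div_lt_iff₀ (by positivity)]; push_cast; nlinarith
  · rw [div_lt_iff₀ (by positivity)]; push_cast; nlinarith

lemma good_face {b1 b2 : ℝ} (h1 : 0 < b1) (h2 : 0 < b2) (h1' : b1 ≤ 1 / 2) (h2' : b2 ≤ 1 / 2) :
    Good b1 b2 (1 / 2) := by
  obtain ⟨m, hm, he, -⟩ := exists_eps (lt_min (lt_min h1 h2) (show (0 : ℝ) < 1 / 2 by norm_num))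
  have hE := good_E m
  have hF := good_F m
  have hpos : 0 < 1 / (2 * ((m + 1 : ℕ) : ℝ)) := by positivity
  set e := 1 / (2 * ((m + 1 : ℕ) : ℝ))
  obtain ⟨⟨e1, e2⟩, e3⟩ : (e < b1 ∧ e < b2) ∧ e < 1 / 2 := by simpa [lt_min_iff] using he
  have hF2 : Good (1 / 2) e (1 / 2) := hF.s12 (by norm_num) hpos (by norm_num) e3.le
  have hd : 0 < 1 / 2 - e := by linarith
  have t1 : 0 ≤ (b1 - e) / (1 / 2 - e) := div_nonneg (by linarith) hd.le
  have t1' : (b1 - e) / (1 / 2 - e) ≤ 1 := by rw [div_le_one hd]; linarith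
  have t2 : 0 ≤ (b2 - e) / (1 / 2 - e) := div_nonneg (by linarith) hd.le
  have t2' : (b2 - e) / (1 / 2 - e) ≤ 1 := by rw [div_le_one hd]; linarith
  have k1 : (b1 - e) / (1 / 2 - e) * (1 / 2 - e) = b1 - e := div_mul_cancel₀ _ hd.ne'
  have k2 : (b2 - e) / (1 / 2 - e) * (1 / 2 - e) = b2 - e := div_mul_cancel₀ _ hd.ne'
  have P : Good b1 e (1 / 2) := by
    refine hE.interp hF2 ?_ ?_ ?_ ?_ ?_ ?_ ?_ ?_ ?_ ?_ _ t1 t1' ?_ ?_ ?_ <;> linarith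
  have Q : Good b1 (1 / 2) (1 / 2) := by
    refine hF.interp good_O ?_ ?_ ?_ ?_ ?_ ?_ ?_ ?_ ?_ ?_ _ t1 t1' ?_ ?_ ?_ <;> linarith
  refine P.interp Q ?_ ?_ ?_ ?_ ?_ ?_ ?_ ?_ ?_ ?_ _ t2 t2' ?_ ?_ ?_ <;> linarith

lemma good_crit {a1 a2 a3 : ℝ} (h1 : 0 < a1) (h2 : 0 < a2) (h3 : 0 < a3) (hs : a1 + a2 + a3 = 1 / 2) :
    Good a1 a2 a3 := by
  obtain ⟨m, hm, -, he⟩ := exists_eps (lt_min (lt_min h1 h2) h3)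
  have hC := good_C m (by omega)
  have hpos : 0 < 1 / (2 * ((m + 2 : ℕ) : ℝ)) := by positivity
  set e := 1 / (2 * ((m + 2 : ℕ) : ℝ)) with hedef
  obtain ⟨⟨e1, e2⟩, e3⟩ : (e < a1 ∧ e < a2) ∧ e < a3 := by simpa [lt_min_iff] using he
  have hd : 0 < 1 / 2 - 3 * e := by linarith
  have hC2 : Good e (1 / 2 - 2 * e) e := hC.s23 hpos (by linarith) hpos (by linarith)
  have hC1 : Good (1 / 2 - 2 * e) e e := hC2.s12 (by linarith) hpos hpos (by linarith)
  have hd2 : 0 < a1 + a2 - 2 * e := by linarith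
  have hd3 : 0 < 1 / 2 - 3 * e := by linarith
  have t1 : 0 ≤ (a2 - e) / (a1 + a2 - 2 * e) := div_nonneg (by linarith) hd2.le
  have t1' : (a2 - e) / (a1 + a2 - 2 * e) ≤ 1 := by rw [div_le_one hd2]; linarith
  have t2 : 0 ≤ (a3 - e) / (1 / 2 - 3 * e) := div_nonneg (by linarith) hd.le
  have t2' : (a3 - e) / (1 / 2 - 3 * e) ≤ 1 := by rw [div_le_one hd]; linarith
  set t := (a2 - e) / (a1 + a2 - 2 * e) with ht
  have htm : t * (a1 + a2 - 2 * e) = a2 - e := div_mul_cancel₀ _ hd2.ne'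
  set s := (a3 - e) / (1 / 2 - 3 * e) with hsd
  have hsm : s * (1 / 2 - 3 * e) = a3 - e := div_mul_cancel₀ _ hd.ne'
  have hsm' : (1 - s) * (1 / 2 - 3 * e) = a1 + a2 - 2 * e := by linarith
  have hP : Good (e + (1 - t) * (1 / 2 - 3 * e)) (e + t * (1 / 2 - 3 * e)) e := by
    refine hC1.interp hC2 ?_ ?_ ?_ ?_ ?_ ?_ ?_ ?_ ?_ ?_ t t1 t1' ?_ ?_ ?_ <;> linarith
  have q1 : 0 ≤ (1 - t) * (1 / 2 - 3 * e) := mul_nonneg (by linarith) hd.le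
  have q2 : 0 ≤ t * (1 / 2 - 3 * e) := mul_nonneg (by linarith) hd.le
  refine hP.interp hC ?_ ?_ ?_ ?_ ?_ ?_ ?_ ?_ ?_ ?_ s t2 t2' ?_ ?_ ?_
  any_goals linarith
  · linear_combination (-(1 - t)) * hsm' + htm
  · linear_combination (-t) * hsm' - htm

lemma good_sorted {a1 a2 a3 : ℝ} (h1 : 0 < a1) (h12 : a1 ≤ a2) (h23 : a2 ≤ a3) (h3 : a3 ≤ 1 / 2)
    (hs : 1 / 2 ≤ a1 + a2 + a3) : Good a1 a2 a3 := by
  have h2 : 0 < a2 := by linarith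
  have h30 : 0 < a3 := by linarith
  rcases hs.eq_or_lt with hs | hs
  · exact good_crit h1 h2 h30 hs.symm
  set S := a1 + a2 + a3 with hS
  have hS0 : 0 < S := by linarith
  set r := 1 / (2 * S) with hr
  set R := 1 / (2 * a3) with hR
  have hr0 : 0 < r := by positivity
  have hR0 : 0 < R := by positivity
  have hrS : r * S = 1 / 2 := by rw [hr]; field_simp
  have hRa : R * a3 = 1 / 2 := by rw [hR]; field_simp
  have hr1 : r < 1 := by rw [hr, div_lt_one (by positivity)]; linarith
  have hR1 : 1 ≤ R := by rw [hR, le_div_iff₀ (by positivity)]; linarith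
  have hlow : Good (r * a1) (r * a2) (r * a3) := by
    apply good_crit (by positivity) (by positivity) (by positivity)
    rw [← hrS]; ring
  have hup : Good (R * a1) (R * a2) (R * a3) := by
    rw [hRa]
    apply good_face (by positivity) (by positivity)
    · rw [← hRa]; gcongr; linarith
    · rw [← hRa]; gcongr
  have hd : 0 < R - r := by linarith
  have t0 : 0 ≤ (1 - r) / (R - r) := div_nonneg (by linarith) hd.le
  have t1 : (1 - r) / (R - r) ≤ 1 := by rw [div_le_one hd]; linarith
  have b1 : R * a1 ≤ 1 / 2 := by rw [← hRa]; gcongr; linarith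
  have b2 : R * a2 ≤ 1 / 2 := by rw [← hRa]; gcongr
  have hRS : r * S ≤ R * S := by gcongr; linarith
  have key : (1 - (1 - r) / (R - r)) * r + (1 - r) / (R - r) * R = 1 := by field_simp; ring
  set t := (1 - r) / (R - r)
  have hl : r * a1 + r * a2 + r * a3 = 1 / 2 := by rw [← hrS]; ring
  have hu : R * a1 + R * a2 + R * a3 = R * S := by ring
  refine hlow.interp hup ?_ ?_ ?_ ?_ ?_ ?_ ?_ ?_ ?_ ?_ t t0 t1 ?_ ?_ ?_
  any_goals positivity
  any_goals linarith
  · linear_combination (-a1) * key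
  · linear_combination (-a2) * key
  · linear_combination (-a3) * key

lemma good_all {a1 a2 a3 : ℝ} (h1 : 0 < a1) (h2 : 0 < a2) (h3 : 0 < a3) (h1' : a1 ≤ 1 / 2)
    (h2' : a2 ≤ 1 / 2) (h3' : a3 ≤ 1 / 2) (hs : 1 / 2 ≤ a1 + a2 + a3) : Good a1 a2 a3 := by
  have step : ∀ {a b c : ℝ}, 0 < a → 0 < b → 0 < c → a ≤ 1 / 2 → b ≤ 1 / 2 → c ≤ 1 / 2 →
      1 / 2 ≤ a + b + c → b ≤ c → Good a b c := by
    intro a b c ha hb hc ha' hb' hc' hs hbc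
    rcases le_total a b with h | h
    · exact good_sorted ha h hbc hc' hs
    · refine Good.s12 ?_ ha hb hc h
      rcases le_total a c with h' | h'
      · exact good_sorted hb h h' hc' (by linarith)
      · refine Good.s23 ?_ hb ha hc h'
        exact good_sorted hb hbc h' ha' (by linarith)
  rcases le_total a2 a3 with h | h
  · exact step h1 h2 h3 h1' h2' h3' hs h
  · refine Good.s23 ?_ h1 h2 h3 h
    exact step h1 h3 h2 h1' h3' h2' (by linarith) h

/-! ### Transfer to `E3` -/

lemma pt3_mp : MeasurePreserving (fun p : ℝ × ℝ × ℝ => pt3 p.1 p.2.1 p.2.2) := by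
  have h1 := PiLp.volume_preserving_toLp (Fin 3)
  have h2 := (volume_preserving_piFinSuccAbove (fun _ : Fin 3 => ℝ) 0).symm
  have h3 := (volume_preserving_finTwoArrow ℝ).symm
  have h4 := (MeasurePreserving.id (volume : Measure ℝ)).prod h3
  have h5 := (h1.comp h2).comp h4
  convert h5 using 1
  · ext p i
    fin_cases i <;> rfl
  · rfl

lemma lint_E3 {F : E3 → ℝ≥0∞} (hF : Measurable F) :
    ∫⁻ x, F x = tri (fun x y z => F (pt3 x y z)) := by
  rw [← pt3_mp.lintegral_comp hF]
  have hm : Measurable (fun p : ℝ × ℝ × ℝ => F (pt3 p.1 p.2.1 p.2.2)) := hF.comp pt3_mp.measurable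
  rw [Measure.volume_eq_prod, lintegral_prod_symm' _ hm, Measure.volume_eq_prod,
    lintegral_prod_symm']
  · rfl
  · exact Measurable.lintegral_prod_left' hm

lemma line_ineq {g : E3 → ℝ} (hg : ContDiff ℝ 1 g) (hc : HasCompactSupport g) (m : ℕ) (p e : E3)
    (he : ‖e‖ = 1) (x : ℝ) :
    ‖g (p + x • e)‖ₑ ^ (m + 1) ≤
      (m + 1 : ℕ) * ∫⁻ t : ℝ, ‖g (p + t • e)‖ₑ ^ m * ‖fderiv ℝ g (p + t • e)‖ₑ := by
  have hiso : Isometry (fun t : ℝ => p + t • e) := by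
    apply Isometry.of_dist_eq
    intro s t
    rw [dist_add_left, dist_eq_norm, ← sub_smul, norm_smul, he, mul_one, dist_eq_norm]
  have hline : ContDiff ℝ 1 (fun t : ℝ => p + t • e) := by fun_prop
  have hcomp : ContDiff ℝ 1 (fun t : ℝ => g (p + t • e)) := hg.comp hline
  have hsupp : HasCompactSupport (fun t : ℝ => g (p + t • e)) :=
    hc.comp_isClosedEmbedding hiso.isClosedEmbedding
  have hpow : HasCompactSupport (fun t : ℝ => g (p + t • e) ^ (m + 1)) :=
    hsupp.comp_left (g := fun s : ℝ => s ^ (m + 1)) (by simp)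
  have key := HasCompactSupport.enorm_le_lintegral_Ici_deriv (hcomp.pow (m + 1)) hpow x
  rw [enorm_pow] at key
  refine key.trans ((setLIntegral_le_lintegral _ _).trans ?_)
  rw [← lintegral_const_mul']
  swap
  · simp
  gcongr with t
  have hd : HasDerivAt (fun t : ℝ => g (p + t • e)) (fderiv ℝ g (p + t • e) e) t := by
    have h1 : HasDerivAt (fun t : ℝ => p + t • e) e t := by
      simpa using ((hasDerivAt_id t).smul_const e).const_add p
    exact ((hg.differentiable one_ne_zero _).hasFDerivAt).comp_hasDerivAt t h1
  have hd2 := hd.fun_pow (m + 1)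
  rw [show deriv (fun t : ℝ => g (p + t • e) ^ (m + 1)) t = _ from hd2.deriv]
  simp only [Nat.add_sub_cancel, enorm_mul, enorm_pow]
  rw [mul_assoc]
  gcongr
  · rw [Real.enorm_natCast]
  · calc _ ≤ ‖fderiv ℝ g (p + t • e)‖ₑ * ‖e‖ₑ := ContinuousLinearMap.le_opENorm _ _
      _ = _ := by
        have : ‖e‖ₑ = 1 := by rw [← ofReal_norm, he]; simp
        rw [this, mul_one]

def KS : ℝ≥0∞ := (SNormLESNormFDerivOfEqConst ℝ (volume : Measure E3) 2 : ℝ≥0∞) ^ 6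

lemma PD_of {g : E3 → ℝ} (hg : ContDiff ℝ 1 g) (hc : HasCompactSupport g) :
    PD KS (fun x y z => ‖g (pt3 x y z)‖ₑ) (fun x y z => ‖fderiv ℝ g (pt3 x y z)‖ₑ) where
  mu := (hg.continuous.measurable.enorm).comp pt3_mp.measurable
  mv := ((hg.continuous_fderiv one_ne_zero).measurable.enorm).comp pt3_mp.measurable
  h1 := by
    intro m x y z
    have e : ∀ t, pt3 t y z = pt3 0 y z + t • EuclideanSpace.single 0 (1 : ℝ) := by
      intro t; ext i; fin_cases i <;> simp [pt3]
    have key := line_ineq hg hc m (pt3 0 y z) (EuclideanSpace.single 0 (1 : ℝ)) (by simp) x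
    simp only [← e] at key
    exact key
  h2 := by
    intro m x y z
    have e : ∀ t, pt3 x t z = pt3 x 0 z + t • EuclideanSpace.single 1 (1 : ℝ) := by
      intro t; ext i; fin_cases i <;> simp [pt3]
    have key := line_ineq hg hc m (pt3 x 0 z) (EuclideanSpace.single 1 (1 : ℝ)) (by simp) y
    simp only [← e] at key
    exact key
  h3 := by
    intro m x y z
    have e : ∀ t, pt3 x y t = pt3 x y 0 + t • EuclideanSpace.single 2 (1 : ℝ) := by
      intro t; ext i; fin_cases i <;> simp [pt3]
    have key := line_ineq hg hc m (pt3 x y 0) (EuclideanSpace.single 2 (1 : ℝ)) (by simp) z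
    simp only [← e] at key
    exact key
  six := by
    rw [← lint_E3 (F := fun x => ‖g x‖ₑ ^ 6) (hg.continuous.measurable.enorm.pow_const 6),
      ← lint_E3 (F := fun x => ‖fderiv ℝ g x‖ₑ ^ 2)
        ((hg.continuous_fderiv one_ne_zero).measurable.enorm.pow_const 2)]
    have key := eLpNorm_le_eLpNorm_fderiv_of_eq (volume : Measure E3) hg hc (p := 2) (p' := 6)
      (by norm_num) (by simp) (by simp; norm_num)
    rw [eLpNorm_nnreal_eq_lintegral (by norm_num), eLpNorm_nnreal_eq_lintegral (by norm_num)] at key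
    have key2 := pow_le_pow_left' key 6
    rw [mul_pow] at key2
    have e6 : ∀ s : ℝ≥0∞, (s ^ (1 / ((6 : NNReal) : ℝ))) ^ 6 = s := by
      intro s; rw [← ENNReal.rpow_natCast, ← ENNReal.rpow_mul]; norm_num
    have e2 : ∀ s : ℝ≥0∞, (s ^ (1 / ((2 : NNReal) : ℝ))) ^ 6 = s ^ 3 := by
      intro s; rw [← ENNReal.rpow_natCast, ← ENNReal.rpow_mul, ← ENNReal.rpow_natCast]; norm_num
    rw [e6, e2] at key2
    have f6 : ∀ s : ℝ≥0∞, s ^ ((6 : NNReal) : ℝ) = s ^ 6 := by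
      intro s; rw [← ENNReal.rpow_natCast]; norm_num
    have f2 : ∀ s : ℝ≥0∞, s ^ ((2 : NNReal) : ℝ) = s ^ 2 := by
      intro s; rw [← ENNReal.rpow_natCast]; norm_num
    simp only [f6, f2] at key2
    exact key2

lemma global_ineq {a1 a2 a3 : ℝ} (h1 : 0 < a1) (h2 : 0 < a2) (h3 : 0 < a3) (h1' : a1 ≤ 1 / 2)
    (h2' : a2 ≤ 1 / 2) (h3' : a3 ≤ 1 / 2) (hs : 1 / 2 ≤ a1 + a2 + a3) :
    ∃ C : ℝ≥0∞, C ≠ ∞ ∧ ∀ g : E3 → ℝ, ContDiff ℝ 1 g → HasCompactSupport g →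
      Nm a1 a2 a3 (fun x y z => ‖g (pt3 x y z)‖ₑ) ≤
        C * (∫⁻ x, ‖fderiv ℝ g x‖ₑ ^ 2) ^ ((3 / 2 - (a1 + a2 + a3)) / 2) *
          (∫⁻ x, ‖g x‖ₑ ^ 2) ^ ((a1 + a2 + a3 - 1 / 2) / 2) := by
  obtain ⟨C, hC, H⟩ := good_all h1 h2 h3 h1' h2' h3' hs KS (by simp [KS])
  refine ⟨C, hC, fun g hg hc => ?_⟩
  rw [lint_E3 (F := fun x => ‖g x‖ₑ ^ 2) (hg.continuous.measurable.enorm.pow_const 2),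
      lint_E3 (F := fun x => ‖fderiv ℝ g x‖ₑ ^ 2)
        ((hg.continuous_fderiv one_ne_zero).measurable.enorm.pow_const 2)]
  exact H _ _ (PD_of hg hc)

/-! ### Poincare inequality on balls -/

lemma sq_lint_le {α : Type*} [MeasurableSpace α] {μ : Measure α} {F : α → ℝ≥0∞}
    (hF : AEMeasurable F μ) : (∫⁻ x, F x ∂μ) ^ 2 ≤ μ univ * ∫⁻ x, F x ^ 2 ∂μ := by
  have h := ENNReal.lintegral_mul_le_Lp_mul_Lq μ (p := 2) (q := 2)
    (Real.HolderConjugate.two_two) (aemeasurable_const (b := (1 : ℝ≥0∞))) hF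
  have h2 := pow_le_pow_left' h 2
  rw [mul_pow] at h2
  have e : ∀ s : ℝ≥0∞, (s ^ (1 / (2 : ℝ))) ^ 2 = s := by
    intro s; rw [← ENNReal.rpow_natCast, ← ENNReal.rpow_mul]; norm_num
  rw [e, e] at h2
  simpa using h2

lemma lint_smul_le {k : E3 → ℝ≥0∞} (hk : Measurable k) {t : ℝ} (ht : 1 / 2 ≤ t) (c : E3) :
    ∫⁻ x, k (c + t • x) ≤ 8 * ∫⁻ x, k x := by
  have ht0 : 0 < t := by linarith
  have h1 : ∫⁻ x, k (c + t • x) = ∫⁻ y, k (c + y) ∂(Measure.map (t • ·) (volume : Measure E3)) := by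
    exact (lintegral_map (f := fun y => k (c + y)) (hk.comp (measurable_const_add c))
      (measurable_const_smul t)).symm
  rw [h1, Measure.map_addHaar_smul _ ht0.ne', lintegral_smul_measure,
    lintegral_add_left_eq_self (fun y => k y) c, smul_eq_mul]
  gcongr
  have h2 : |(t ^ Module.finrank ℝ E3)⁻¹| ≤ 8 := by
    rw [abs_of_pos (by positivity)]
    have : Module.finrank ℝ E3 = 3 := by simp
    rw [this]
    rw [inv_le_comm₀ (by positivity) (by norm_num)]
    calc (8 : ℝ)⁻¹ = (1 / 2) ^ 3 := by norm_num
      _ ≤ t ^ 3 := by gcongr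
  calc _ ≤ ENNReal.ofReal 8 := ENNReal.ofReal_le_ofReal h2
    _ = 8 := by simp

lemma seg_ineq {f : E3 → ℝ} (hf : ContDiff ℝ 1 f) (x y : E3) :
    ‖f x - f y‖ₑ ^ 2 ≤ ‖x - y‖ₑ ^ 2 *
      ∫⁻ t in Ioc (0 : ℝ) 1, ‖fderiv ℝ f ((1 - t) • y + t • x)‖ₑ ^ 2 := by
  have hline : Continuous (fun t : ℝ => (1 - t) • y + t • x) := by fun_prop
  have hfd : Continuous (fun t : ℝ => fderiv ℝ f ((1 - t) • y + t • x)) :=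
    (hf.continuous_fderiv one_ne_zero).comp hline
  have hd : ∀ t : ℝ, HasDerivAt (fun t : ℝ => f ((1 - t) • y + t • x))
      (fderiv ℝ f ((1 - t) • y + t • x) (x - y)) t := by
    intro t
    have h1 : HasDerivAt (fun t : ℝ => (1 - t) • y + t • x) (x - y) t := by
      have := (((hasDerivAt_id t).const_sub 1).smul_const y).add
        ((hasDerivAt_id t).smul_const x)
      have e : (-1 : ℝ) • y + (1 : ℝ) • x = x - y := by
        rw [neg_smul, one_smul, one_smul]; abel
      rw [e] at this
      exact this
    exact ((hf.differentiable one_ne_zero _).hasFDerivAt).comp_hasDerivAt t h1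
  have hcd : Continuous (fun t : ℝ => fderiv ℝ f ((1 - t) • y + t • x) (x - y)) :=
    hfd.clm_apply continuous_const
  have ftc := intervalIntegral.integral_eq_sub_of_hasDerivAt (a := 0) (b := 1)
    (fun t _ => hd t) (hcd.intervalIntegrable _ _)
  simp only [sub_zero, one_smul, zero_smul, add_zero, sub_self, zero_add] at ftc
  rw [← ftc, intervalIntegral.integral_of_le zero_le_one]
  calc _ ≤ (∫⁻ t in Ioc (0 : ℝ) 1, ‖fderiv ℝ f ((1 - t) • y + t • x) (x - y)‖ₑ) ^ 2 := by
        gcongr; exact enorm_integral_le_lintegral_enorm _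
    _ ≤ _ := sq_lint_le hcd.measurable.enorm.aemeasurable
    _ = ∫⁻ t in Ioc (0 : ℝ) 1, ‖fderiv ℝ f ((1 - t) • y + t • x) (x - y)‖ₑ ^ 2 := by simp
    _ ≤ ∫⁻ t in Ioc (0 : ℝ) 1, ‖x - y‖ₑ ^ 2 * ‖fderiv ℝ f ((1 - t) • y + t • x)‖ₑ ^ 2 := by
        gcongr with t
        rw [← mul_pow, mul_comm]
        gcongr
        exact ContinuousLinearMap.le_opENorm _ _
    _ = _ := by rw [lintegral_const_mul' _ _ (by simp)]

lemma mean_ineq {f : E3 → ℝ} (hf : Continuous f) {R : ℝ} (hR : 0 < R)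
    (h0 : ∫ x in ball (0 : E3) R, f x = 0) (x : E3) :
    volume (ball (0 : E3) R) * ‖f x‖ₑ ^ 2 ≤ ∫⁻ y in ball (0 : E3) R, ‖f x - f y‖ₑ ^ 2 := by
  set V := volume (ball (0 : E3) R) with hV
  have hV0 : V ≠ 0 := (measure_ball_pos volume _ hR).ne'
  have hVt : V ≠ ∞ := measure_ball_lt_top.ne
  have hintg : IntegrableOn f (ball (0 : E3) R) :=
    (hf.continuousOn.integrableOn_compact (isCompact_closedBall 0 R)).mono_set ball_subset_closedBall
  have e1 : ∫ y in ball (0 : E3) R, (f x - f y) = V.toReal * f x := by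
    have hconst : Integrable (fun _ : E3 => f x) (volume.restrict (ball (0 : E3) R)) :=
      integrableOn_const (C := f x) hVt
    rw [integral_sub hconst hintg, h0]
    simp [Measure.real, hV]
  have e2 : V * ‖f x‖ₑ ≤ ∫⁻ y in ball (0 : E3) R, ‖f x - f y‖ₑ := by
    have := enorm_integral_le_lintegral_enorm (μ := volume.restrict (ball (0 : E3) R))
      (fun y => f x - f y)
    rw [e1, enorm_mul] at this
    convert this using 2
    rw [Real.enorm_eq_ofReal ENNReal.toReal_nonneg, ENNReal.ofReal_toReal hVt]
  have e3 := (pow_le_pow_left' e2 2).trans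
    (sq_lint_le (continuous_const.sub hf).measurable.enorm.aemeasurable)
  rw [Measure.restrict_apply_univ, ← hV, mul_pow, sq V, mul_assoc] at e3
  exact (ENNReal.mul_le_mul_iff_right hV0 hVt).1 e3

set_option maxHeartbeats 1000000 in
lemma poincare {f : E3 → ℝ} (hf : ContDiff ℝ 1 f) {R : ℝ} (hR : 0 < R)
    (h0 : ∫ x in ball (0 : E3) R, f x = 0) :
    ∫⁻ x in ball (0 : E3) R, ‖f x‖ₑ ^ 2 ≤
      ENNReal.ofReal (32 * R ^ 2) * ∫⁻ x in ball (0 : E3) R, ‖fderiv ℝ f x‖ₑ ^ 2 := by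
  set B := ball (0 : E3) R with hB
  have hBm : MeasurableSet B := measurableSet_ball
  set V := volume B with hV
  have hV0 : V ≠ 0 := (measure_ball_pos volume _ hR).ne'
  have hVt : V ≠ ∞ := measure_ball_lt_top.ne
  set k : E3 → ℝ≥0∞ := B.indicator (fun x => ‖fderiv ℝ f x‖ₑ ^ 2) with hk
  have hkm : Measurable k :=
    ((hf.continuous_fderiv one_ne_zero).measurable.enorm.pow_const 2).indicator hBm
  have hkint : ∫⁻ x in B, ‖fderiv ℝ f x‖ₑ ^ 2 = ∫⁻ x, k x := (lintegral_indicator hBm _).symm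
  rw [hkint]
  have step1 : ∀ x ∈ B, ∀ y ∈ B, ‖f x - f y‖ₑ ^ 2 ≤
      ENNReal.ofReal (4 * R ^ 2) * ∫⁻ t in Ioc (0 : ℝ) 1, k ((1 - t) • y + t • x) := by
    intro x hx y hy
    refine (seg_ineq hf x y).trans ?_
    gcongr ?_ * ?_
    · rw [← ofReal_norm, ← ENNReal.ofReal_pow (norm_nonneg _)]
      apply ENNReal.ofReal_le_ofReal
      have h1 : ‖x‖ < R := by simpa [hB] using hx
      have h2 : ‖y‖ < R := by simpa [hB] using hy
      have h3 : ‖x - y‖ ≤ 2 * R := (norm_sub_le x y).trans (by linarith)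
      calc ‖x - y‖ ^ 2 ≤ (2 * R) ^ 2 := by gcongr
        _ = _ := by ring
    · apply setLIntegral_mono' measurableSet_Ioc
      intro t ht
      have : (1 - t) • y + t • x ∈ B :=
        convex_ball (0 : E3) R hy hx (by linarith [ht.2]) ht.1.le (by ring)
      rw [hk, indicator_of_mem this]
  have hjoint : Measurable (fun p : (E3 × E3) × ℝ => k ((1 - p.2) • p.1.2 + p.2 • p.1.1)) := by
    apply hkm.comp
    have : Continuous (fun p : (E3 × E3) × ℝ => (1 - p.2) • p.1.2 + p.2 • p.1.1) := by fun_prop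
    exact this.measurable
  have step2 : ∀ t ∈ Ioc (0 : ℝ) 1, ∫⁻ x in B, ∫⁻ y in B, k ((1 - t) • y + t • x) ≤
      8 * V * ∫⁻ x, k x := by
    intro t ht
    rcases le_total (1 / 2) t with h | h
    · rw [lintegral_lintegral_swap]
      · calc _ ≤ ∫⁻ y in B, 8 * ∫⁻ x, k x := by
              gcongr with y
              exact (setLIntegral_le_lintegral _ _).trans (lint_smul_le hkm h _)
          _ = _ := by rw [setLIntegral_const]; ring
      · exact (hjoint.comp (measurable_id.prodMk measurable_const)).aemeasurable
    · calc _ ≤ ∫⁻ x in B, 8 * ∫⁻ x, k x := by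
              gcongr with x
              refine (setLIntegral_le_lintegral _ _).trans ?_
              simp_rw [add_comm _ (t • x)]
              exact lint_smul_le hkm (by linarith) _
          _ = _ := by rw [setLIntegral_const]; ring
  have hconst : ENNReal.ofReal (32 * R ^ 2) = 8 * ENNReal.ofReal (4 * R ^ 2) := by
    have e : (32 * R ^ 2 : ℝ) = 8 * (4 * R ^ 2) := by ring
    rw [e, ENNReal.ofReal_mul (by norm_num)]
    simp
  have step3 : V * ∫⁻ x in B, ‖f x‖ₑ ^ 2 ≤ V * (ENNReal.ofReal (32 * R ^ 2) * ∫⁻ x, k x) := by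
    calc V * ∫⁻ x in B, ‖f x‖ₑ ^ 2 = ∫⁻ x in B, V * ‖f x‖ₑ ^ 2 := by
          rw [lintegral_const_mul' _ _ hVt]
      _ ≤ ∫⁻ x in B, ∫⁻ y in B, ENNReal.ofReal (4 * R ^ 2) *
            ∫⁻ t in Ioc (0 : ℝ) 1, k ((1 - t) • y + t • x) := by
          apply setLIntegral_mono' hBm
          intro x hx
          refine (mean_ineq hf.continuous hR h0 x).trans ?_
          apply setLIntegral_mono' hBm
          intro y hy
          exact step1 x hx y hy
      _ = ENNReal.ofReal (4 * R ^ 2) * ∫⁻ x in B, ∫⁻ y in B,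
            ∫⁻ t in Ioc (0 : ℝ) 1, k ((1 - t) • y + t • x) := by
          simp_rw [lintegral_const_mul' _ _ (ENNReal.ofReal_ne_top (r := 4 * R ^ 2))]
      _ = ENNReal.ofReal (4 * R ^ 2) * ∫⁻ t in Ioc (0 : ℝ) 1, ∫⁻ x in B, ∫⁻ y in B,
            k ((1 - t) • y + t • x) := by
          congr 1
          have hi : ∀ x, ∫⁻ y in B, ∫⁻ t in Ioc (0 : ℝ) 1, k ((1 - t) • y + t • x) =
              ∫⁻ t in Ioc (0 : ℝ) 1, ∫⁻ y in B, k ((1 - t) • y + t • x) := by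
            intro x
            rw [lintegral_lintegral_swap]
            exact (hjoint.comp ((measurable_const.prodMk measurable_fst).prodMk
              measurable_snd)).aemeasurable
          simp_rw [hi]
          have hm3 : Measurable (fun p : (E3 × ℝ) × E3 => k ((1 - p.1.2) • p.2 + p.1.2 • p.1.1)) :=
            hkm.comp (Continuous.measurable (by fun_prop))
          have hm4 : Measurable (fun p : E3 × ℝ =>
              ∫⁻ y in B, k ((1 - p.2) • y + p.2 • p.1)) := hm3.lintegral_prod_right'
          exact lintegral_lintegral_swap hm4.aemeasurable
      _ ≤ ENNReal.ofReal (4 * R ^ 2) * ∫⁻ t in Ioc (0 : ℝ) 1, 8 * V * ∫⁻ x, k x := by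
          exact mul_le_mul' le_rfl (setLIntegral_mono' measurableSet_Ioc step2)
      _ = V * (ENNReal.ofReal (32 * R ^ 2) * ∫⁻ x, k x) := by
          rw [setLIntegral_const, hconst]
          generalize ∫⁻ x, k x = I
          simp only [Real.volume_Ioc, sub_zero, ENNReal.ofReal_one, mul_one]
          ring
  exact (ENNReal.mul_le_mul_iff_right hV0 hVt).1 step3

/-! ### Cutoff and conclusion -/

lemma cutoff_exists : ∃ M : ℝ, 0 ≤ M ∧ ∀ r : ℝ, 0 < r → ∃ φ : E3 → ℝ, ContDiff ℝ 1 φ ∧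
    HasCompactSupport φ ∧ (∀ x ∈ ball (0 : E3) r, φ x = 1) ∧ (∀ x, |φ x| ≤ 1) ∧
    (∀ x, ‖fderiv ℝ φ x‖ ≤ M / r) ∧
    (∀ x, x ∉ ball (0 : E3) (Real.sqrt 2 * r) → φ x = 0 ∧ fderiv ℝ φ x = 0) := by
  let φ₀ : ContDiffBump (0 : E3) := ⟨1, 6 / 5, by norm_num, by norm_num⟩
  have hcd : ContDiff ℝ 1 (φ₀ : E3 → ℝ) := φ₀.contDiff
  have hcs : HasCompactSupport (φ₀ : E3 → ℝ) := φ₀.hasCompactSupport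
  obtain ⟨M, hM⟩ := (hcs.fderiv ℝ).exists_bound_of_continuous (hcd.continuous_fderiv one_ne_zero)
  have hM0 : 0 ≤ M := (norm_nonneg _).trans (hM 0)
  refine ⟨M, hM0, fun r hr => ⟨fun x => φ₀ (r⁻¹ • x), ?_, ?_, ?_, ?_, ?_, ?_⟩⟩
  · exact hcd.comp (contDiff_const_smul _)
  · exact hcs.comp_smul (inv_ne_zero hr.ne')
  · intro x hx
    apply φ₀.one_of_mem_closedBall
    rw [mem_closedBall_zero_iff, norm_smul, norm_inv, Real.norm_of_nonneg hr.le]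
    rw [mem_ball_zero_iff] at hx
    show r⁻¹ * ‖x‖ ≤ 1
    rw [inv_mul_le_iff₀ hr]; linarith
  · intro x
    rw [abs_of_nonneg φ₀.nonneg]; exact φ₀.le_one
  · intro x
    rw [fderiv_comp_smul, norm_smul, norm_inv, Real.norm_of_nonneg hr.le, div_eq_inv_mul]
    gcongr
    exact hM _
  · intro x hx
    have hn : r⁻¹ • x ∉ tsupport (φ₀ : E3 → ℝ) := by
      rw [φ₀.tsupport_eq, mem_closedBall_zero_iff, norm_smul, norm_inv, Real.norm_of_nonneg hr.le]
      rw [mem_ball_zero_iff, not_lt] at hx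
      show ¬ (r⁻¹ * ‖x‖ ≤ 6 / 5)
      rw [inv_mul_le_iff₀ hr, not_le]
      have : (6 / 5 : ℝ) < Real.sqrt 2 := Real.lt_sqrt_of_sq_lt (by norm_num)
      nlinarith
    refine ⟨image_eq_zero_of_notMem_tsupport hn, ?_⟩
    rw [fderiv_comp_smul, fderiv_of_notMem_tsupport ℝ hn, smul_zero]

lemma localize : ∃ K : ℝ≥0∞, K ≠ ∞ ∧ ∀ r : ℝ, 0 < r → ∀ f : E3 → ℝ, ContDiff ℝ 1 f →
    (∫ x in ball (0 : E3) (Real.sqrt 2 * r), f x) = 0 →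
    ∃ g : E3 → ℝ, ContDiff ℝ 1 g ∧ HasCompactSupport g ∧ (∀ x ∈ ball (0 : E3) r, g x = f x) ∧
      ∫⁻ x, ‖fderiv ℝ g x‖ₑ ^ 2 ≤
        K * ∫⁻ x in ball (0 : E3) (Real.sqrt 2 * r), ‖fderiv ℝ f x‖ₑ ^ 2 ∧
      ∫⁻ x, ‖g x‖ₑ ^ 2 ≤ ∫⁻ x in ball (0 : E3) (Real.sqrt 2 * r), ‖f x‖ₑ ^ 2 := by
  obtain ⟨M, hM0, hM⟩ := cutoff_exists
  refine ⟨2 + ENNReal.ofReal (128 * M ^ 2), by finiteness, fun r hr f hf h0 => ?_⟩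
  obtain ⟨φ, hφ, hφc, hφ1, hφle, hφd, hφ0⟩ := hM r hr
  set B := ball (0 : E3) (Real.sqrt 2 * r) with hB
  have hBm : MeasurableSet B := measurableSet_ball
  have hfd : ∀ x, fderiv ℝ (fun y => φ y * f y) x = φ x • fderiv ℝ f x + f x • fderiv ℝ φ x :=
    fun x => fderiv_fun_mul (hφ.differentiable one_ne_zero x) (hf.differentiable one_ne_zero x)
  have hR : 0 < Real.sqrt 2 * r := by positivity
  refine ⟨fun x => φ x * f x, hφ.mul hf, hφc.mul_right, ?_, ?_, ?_⟩
  · intro x hx; simp [hφ1 x hx]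
  · have pw : ∀ x, ‖fderiv ℝ (fun y => φ y * f y) x‖ₑ ^ 2 ≤
        B.indicator (fun x => 2 * ‖fderiv ℝ f x‖ₑ ^ 2 +
          ENNReal.ofReal (2 * (M / r) ^ 2) * ‖f x‖ₑ ^ 2) x := by
      intro x
      by_cases hx : x ∈ B
      · rw [indicator_of_mem hx, hfd]
        have h1 : ‖φ x • fderiv ℝ f x + f x • fderiv ℝ φ x‖ ≤
            ‖fderiv ℝ f x‖ + (M / r) * ‖f x‖ := by
          refine (norm_add_le _ _).trans ?_
          rw [norm_smul, norm_smul]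
          have a1 : ‖φ x‖ * ‖fderiv ℝ f x‖ ≤ 1 * ‖fderiv ℝ f x‖ := by
            gcongr; exact hφle x
          have a2 : ‖f x‖ * ‖fderiv ℝ φ x‖ ≤ ‖f x‖ * (M / r) := by
            gcongr; exact hφd x
          linarith
        have h2 : ‖φ x • fderiv ℝ f x + f x • fderiv ℝ φ x‖ ^ 2 ≤
            2 * ‖fderiv ℝ f x‖ ^ 2 + (2 * (M / r) ^ 2) * ‖f x‖ ^ 2 := by
          calc _ ≤ (‖fderiv ℝ f x‖ + (M / r) * ‖f x‖) ^ 2 := by gcongr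
            _ ≤ _ := by nlinarith [sq_nonneg (‖fderiv ℝ f x‖ - (M / r) * ‖f x‖)]
        have h3 := ENNReal.ofReal_le_ofReal h2
        rw [ENNReal.ofReal_add (by positivity) (by positivity), ENNReal.ofReal_mul (by positivity),
          ENNReal.ofReal_mul (by positivity), ENNReal.ofReal_pow (by positivity),
          ENNReal.ofReal_pow (by positivity), ENNReal.ofReal_pow (by positivity)] at h3
        simpa only [ofReal_norm, ENNReal.ofReal_ofNat] using h3
      · rw [indicator_of_notMem hx, hfd, (hφ0 x hx).1, (hφ0 x hx).2, zero_smul, smul_zero, add_zero,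
          ← ofReal_norm, norm_zero]
        simp
    have mfd : Measurable (fun x => ‖fderiv ℝ f x‖ₑ ^ 2) :=
      (hf.continuous_fderiv one_ne_zero).measurable.enorm.pow_const 2
    calc _ ≤ _ := lintegral_mono pw
      _ = 2 * (∫⁻ x in B, ‖fderiv ℝ f x‖ₑ ^ 2) +
          ENNReal.ofReal (2 * (M / r) ^ 2) * ∫⁻ x in B, ‖f x‖ₑ ^ 2 := by
          rw [lintegral_indicator hBm, lintegral_add_left (mfd.const_mul 2),
            lintegral_const_mul' _ _ (by finiteness), lintegral_const_mul' _ _ (by finiteness)]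
      _ ≤ 2 * (∫⁻ x in B, ‖fderiv ℝ f x‖ₑ ^ 2) +
          ENNReal.ofReal (2 * (M / r) ^ 2) *
            (ENNReal.ofReal (32 * (Real.sqrt 2 * r) ^ 2) * ∫⁻ x in B, ‖fderiv ℝ f x‖ₑ ^ 2) := by
          gcongr
          exact poincare hf hR h0
      _ = _ := by
          rw [← mul_assoc, ← ENNReal.ofReal_mul (by positivity), add_mul]
          congr 3
          rw [mul_pow, Real.sq_sqrt (by norm_num)]
          field_simp
          ring
  · rw [← lintegral_indicator hBm]
    apply lintegral_mono
    intro x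
    by_cases hx : x ∈ B
    · simp only [indicator_of_mem hx, enorm_mul]
      have : ‖φ x‖ₑ ≤ 1 := by
        rw [← ofReal_norm]
        exact ENNReal.ofReal_le_one.2 (hφle x)
      calc (‖φ x‖ₑ * ‖f x‖ₑ) ^ 2 ≤ (1 * ‖f x‖ₑ) ^ 2 := by gcongr
        _ = _ := by rw [one_mul]
    · simp [indicator_of_notMem hx, (hφ0 x hx).1]

lemma anisoNorm_le {q1 q2 q3 : ℝ} (h1 : 0 < q1) (h2 : 0 < q2) (h3 : 0 < q3) {r : ℝ}
    {f g : E3 → ℝ} (hfg : ∀ x ∈ ball (0 : E3) r, g x = f x) :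
    anisoNorm q1 q2 q3 (ball (0 : E3) r) f ≤
      Nm (1 / q1) (1 / q2) (1 / q3) (fun x y z => ‖g (pt3 x y z)‖ₑ) := by
  have e : anisoNorm q1 q2 q3 (ball (0 : E3) r) f = Nm (1 / q1) (1 / q2) (1 / q3)
      (fun x y z => ENNReal.ofReal |(ball (0 : E3) r).indicator f (pt3 x y z)|) := by
    unfold anisoNorm Nm Ln
    simp only [one_div_one_div, ← ENNReal.rpow_mul]
    simp only [one_div_mul_eq_div]
  rw [e]
  unfold Nm
  refine Ln_mono (by positivity) fun z => Ln_mono (by positivity) fun y =>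
    Ln_mono (by positivity) fun x => ?_
  beta_reduce
  by_cases hx : pt3 x y z ∈ ball (0 : E3) r
  · rw [indicator_of_mem hx, hfg _ hx, ← Real.norm_eq_abs, ofReal_norm]
  · rw [indicator_of_notMem hx]; simp

lemma l2On_rpow (s : Set E3) (g : E3 → ℝ) (p : ℝ) :
    l2On s g ^ p = (∫⁻ x in s, ‖g x‖ₑ ^ 2) ^ (p / 2) := by
  unfold l2On
  rw [← ENNReal.rpow_mul]
  simp only [← Real.norm_eq_abs, ofReal_norm]
  congr 1; ring

/-- Inequality (2.7): local anisotropic Sobolev inequality for mean-zero functions: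
for `q_j ∈ [2,∞)` with `0 ≤ 1/q̄ − 1/2 ≤ 1`, `ϱ > 0` and `f ∈ C^∞(ℝ³)` with
`∫_{B(√2ϱ)} f = 0`:
`‖f‖_{L^{q⃗}(B(ϱ))} ≤ C ‖∇f‖_{L²(B(√2ϱ))}^{3/2−1/q̄} ‖f‖_{L²(B(√2ϱ))}^{1/q̄−1/2}`. -/
theorem aniso_sobolev_mean_zero
    (q1 q2 q3 : ℝ) (hq1 : 2 ≤ q1) (hq2 : 2 ≤ q2) (hq3 : 2 ≤ q3)
    (h0 : 0 ≤ 1/q1 + 1/q2 + 1/q3 - 1/2) (h1 : 1/q1 + 1/q2 + 1/q3 - 1/2 ≤ 1) :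
    ∃ C : ℝ, 0 < C ∧
      ∀ (ϱ : ℝ), 0 < ϱ → ∀ f : E3 → ℝ, ContDiff ℝ (⊤ : ℕ∞) f →
        (∫ x in ball (0 : E3) (Real.sqrt 2 * ϱ), f x) = 0 →
        anisoNorm q1 q2 q3 (ball (0 : E3) ϱ) f
          ≤ ENNReal.ofReal C
              * (l2On (ball (0 : E3) (Real.sqrt 2 * ϱ)) (fun x => ‖fderiv ℝ f x‖))
                  ^ (3/2 - (1/q1 + 1/q2 + 1/q3))
              * (l2On (ball (0 : E3) (Real.sqrt 2 * ϱ)) f) ^ (1/q1 + 1/q2 + 1/q3 - 1/2) := by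
  have hp1 : 0 < q1 := by linarith
  have hp2 : 0 < q2 := by linarith
  have hp3 : 0 < q3 := by linarith
  have half : ∀ q : ℝ, 2 ≤ q → 1 / q ≤ 1 / 2 := fun q hq =>
    one_div_le_one_div_of_le (by norm_num) hq
  obtain ⟨C, hC, H⟩ := global_ineq (a1 := 1 / q1) (a2 := 1 / q2) (a3 := 1 / q3)
    (by positivity) (by positivity) (by positivity) (half _ hq1) (half _ hq2) (half _ hq3)
    (by linarith)
  obtain ⟨K, hK, L⟩ := localize
  set s := 1 / q1 + 1 / q2 + 1 / q3 with hs
  have hα : 0 ≤ (3 / 2 - s) / 2 := by linarith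
  have hβ : 0 ≤ (s - 1 / 2) / 2 := by linarith
  have hD : C * K ^ ((3 / 2 - s) / 2) ≠ ∞ :=
    ENNReal.mul_ne_top hC (ENNReal.rpow_ne_top_of_nonneg hα hK)
  refine ⟨(C * K ^ ((3 / 2 - s) / 2)).toReal + 1, by positivity, fun r hr f hf h0 => ?_⟩
  have hf1 : ContDiff ℝ 1 f := hf.of_le (by exact_mod_cast le_top)
  obtain ⟨g, hg, hgc, hgf, hgd, hg2⟩ := L r hr f hf1 h0
  rw [l2On_rpow, l2On_rpow]
  simp only [enorm_norm]
  calc _ ≤ _ := anisoNorm_le hp1 hp2 hp3 hgf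
    _ ≤ _ := H g hg hgc
    _ ≤ C * (K * ∫⁻ x in ball (0 : E3) (Real.sqrt 2 * r), ‖fderiv ℝ f x‖ₑ ^ 2) ^ ((3 / 2 - s) / 2)
        * (∫⁻ x in ball (0 : E3) (Real.sqrt 2 * r), ‖f x‖ₑ ^ 2) ^ ((s - 1 / 2) / 2) := by
        gcongr
    _ = C * K ^ ((3 / 2 - s) / 2) *
        (∫⁻ x in ball (0 : E3) (Real.sqrt 2 * r), ‖fderiv ℝ f x‖ₑ ^ 2) ^ ((3 / 2 - s) / 2)
        * (∫⁻ x in ball (0 : E3) (Real.sqrt 2 * r), ‖f x‖ₑ ^ 2) ^ ((s - 1 / 2) / 2) := by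
        rw [ENNReal.mul_rpow_of_nonneg _ _ hα, ← mul_assoc C]
    _ ≤ _ := by
        gcongr
        rw [← ENNReal.ofReal_toReal hD]
        apply ENNReal.ofReal_le_ofReal
        rw [ENNReal.toReal_ofReal ENNReal.toReal_nonneg]
        linarith
end
end
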